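/- Let 𝒥 be a marked ribbon k-tree and α_𝒥(x) = (−1)^l ∫_{I_x} τ⃗*(dη_{i_{e₁}} ∧ ⋯ ∧ dη_{i_{e_k}}) the associated ℏ-dependent function (l the length of the core). Then: (1) α_𝒥 ∈ W^0_{P_𝒥}(M_ℝ) ∩ W^0_0(M_ℝ) if dim_ℝ(P_𝒥) = r, and α_𝒥 ∈ W^0_0(M_ℝ) otherwise; in either case α_𝒥|_{M_ℝ∖P_𝒥} ∈ W^{−∞}_0(M_ℝ∖P_𝒥). (2) If dim_ℝ(P_𝒥) = r, there exists a polyhedral decomposition 𝒫_𝒥 of P_𝒥 such that d(α_𝒥)|_{M_ℝ∖|𝒫_𝒥^{[r−1]}|} ∈ W^{−∞}_1(M_ℝ∖|𝒫_𝒥^{[r−1]}|). -/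

import Mathlib

/-!
STATEMENT 16 (Lemma `solution_asy_support_marked`).  Let `𝒥` be a marked
ribbon `k`-tree and
`α_𝒥(x) = (-1)^l ∫_{I_x} τ⃗^*(dη_{i_{e₁}} ∧ ⋯ ∧ dη_{i_{e_k}})`
the associated `ℏ`-dependent function (`l` the length of the core).  Then:
(1) `α_𝒥 ∈ W^0_{P_𝒥}(M_ℝ) ∩ W^0_0(M_ℝ)` if `dim_ℝ(P_𝒥) = r`, and
    `α_𝒥 ∈ W^0_0(M_ℝ)` otherwise; in either case
    `α_𝒥|_{M_ℝ ∖ P_𝒥} ∈ W^{-∞}_0(M_ℝ ∖ P_𝒥)`;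
(2) if `dim_ℝ(P_𝒥) = r`, there exists a polyhedral decomposition `𝒫_𝒥` of
    `P_𝒥` such that `d(α_𝒥)` is exponentially small away from the union
    `|𝒫_𝒥^{[r-1]}|` of the (≤ r-1)-dimensional strata.

The marked-tree combinatorics, the Gaussian moduli integral `α_𝒥`, and the
weighted spaces of `ℏ`-dependent forms are as in the companion statements.
-/

open MeasureTheory

open MeasureTheory

namespace Scattering16

def dotR {r : ℕ} (x y : Fin r → ℝ) : ℝ := ∑ i, x i * y i
def toR {r : ℕ} (m : Fin r → ℤ) : Fin r → ℝ := fun i => (m i : ℝ)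
def pairZ {r : ℕ} (m n : Fin r → ℤ) : ℤ := ∑ i, m i * n i

structure Wall (r : ℕ) where
  mdir : Fin r → ℤ
  mult : ℕ
  nvec : Fin r → ℤ
  c : ℚ    -- walls are rational (tropical) polyhedral subsets
  vars : Finset (ℕ × ℕ)      -- the set J_e of (nilpotent) variables u_{is}
  mult_pos : 0 < mult
  mdir_ne : mdir ≠ 0
  nvec_ne : nvec ≠ 0
  orth : pairZ mdir nvec = 0

def Wall.mweight {r : ℕ} (w : Wall r) : Fin r → ℤ := (w.mult : ℤ) • w.mdir
def Wall.eta {r : ℕ} (w : Wall r) (x : Fin r → ℝ) : ℝ := dotR x (toR w.nvec) - (w.c : ℝ)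
def Wall.support {r : ℕ} (w : Wall r) : Set (Fin r → ℝ) := {x | w.eta x = 0}

inductive Tree (ι : Type) where
  | leaf : ι → Tree ι
  | node : Tree ι → Tree ι → Tree ι

namespace Tree

variable {r : ℕ} {ι : Type}

def mOf (w : ι → Wall r) : Tree ι → Fin r → ℤ
  | .leaf i => (w i).mweight
  | .node t₁ t₂ => mOf w t₁ + mOf w t₂

def nOf (w : ι → Wall r) : Tree ι → Fin r → ℤ
  | .leaf i => (w i).nvec
  | .node t₁ t₂ =>
      pairZ (mOf w t₂) (nOf w t₁) • nOf w t₂ - pairZ (mOf w t₁) (nOf w t₂) • nOf w t₁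

def numNodes : Tree ι → ℕ
  | .leaf _ => 0
  | .node t₁ t₂ => numNodes t₁ + numNodes t₂ + 1

/-- the ribbon-compatible representative of the sign-ambiguous pair `±n_𝒯` -/
def nOrient (w : ι → Wall r) (T : Tree ι) : Fin r → ℤ :=
  ((-1 : ℤ) ^ T.numNodes) • T.nOf w

def leaves : Tree ι → List ι
  | .leaf i => [i]
  | .node t₁ t₂ => leaves t₁ ++ leaves t₂

/-- the locus of stops `P_𝒯` -/
def stops (w : ι → Wall r) : Tree ι → Set (Fin r → ℝ)
  | .leaf i => (w i).support
  | .node t₁ t₂ => {x | ∃ y, (y ∈ stops w t₁ ∧ y ∈ stops w t₂) ∧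
      ∃ t : ℝ, 0 ≤ t ∧ x = y - t • toR (mOf w t₁ + mOf w t₂)}

/-- the constant covector obtained by contracting the pullback `k`-form
`τ⃗^*(dη_{i_{e₁}} ∧ ⋯ ∧ dη_{i_{e_k}})` with the edge-length directions; it is
a positive multiple of `nOrient`. -/
def covec (w : ι → Wall r) : Tree ι → Fin r → ℝ
  | .leaf i => toR (w i).nvec
  | .node t₁ t₂ =>
      dotR (-(toR (mOf w t₁ + mOf w t₂))) (covec w t₁) • covec w t₂
    - dotR (-(toR (mOf w t₁ + mOf w t₂))) (covec w t₂) • covec w t₁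

/-- the space of edge lengths `ℝ^{𝒯^{[1]}}` -/
def Lengths : Tree ι → Type
  | .leaf _ => Unit
  | .node t₁ t₂ => Lengths t₁ × Lengths t₂ × ℝ

noncomputable instance instMeasureSpaceLengths : (T : Tree ι) → MeasureSpace T.Lengths
  | .leaf _ => inferInstanceAs (MeasureSpace Unit)
  | .node t₁ t₂ =>
      letI := instMeasureSpaceLengths t₁
      letI := instMeasureSpaceLengths t₂
      (inferInstance : MeasureSpace (Lengths t₁ × Lengths t₂ × ℝ))

/-- the region `ℝ_{≤0}^{𝒯^{[1]}}` (so `I_x` is `{ℓ | Nonpos 𝒯 ℓ} × {x}`) -/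
def Nonpos : (T : Tree ι) → T.Lengths → Prop
  | .leaf _ => fun _ => True
  | .node t₁ t₂ => fun ℓ => Nonpos t₁ ℓ.1 ∧ Nonpos t₂ ℓ.2.1 ∧ ℓ.2.2 ≤ 0

/-- the truncated region `[-L,0]^{𝒯^{[1]}}` -/
def NonposTrunc (L : ℝ) : (T : Tree ι) → T.Lengths → Prop
  | .leaf _ => fun _ => True
  | .node t₁ t₂ => fun ℓ =>
      NonposTrunc L t₁ ℓ.1 ∧ NonposTrunc L t₂ ℓ.2.1 ∧ ℓ.2.2 ∈ Set.Icc (-L) 0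

noncomputable def gauss (ℏ t : ℝ) : ℝ :=
  (Real.pi * ℏ) ^ (-(1:ℝ)/2) * Real.exp (-(t^2) / ℏ)

/-- the product of the Gaussian factors `δ_{P_{i_{e_j} J_{e_j}}}` pulled back
by the composite flows `τ^{𝔢_j}` (`τ^m_s(x) = x - s m`) -/
noncomputable def gaussProd (w : ι → Wall r) (ℏ : ℝ) :
    (T : Tree ι) → T.Lengths → (Fin r → ℝ) → ℝ
  | .leaf i => fun _ x => gauss ℏ ((w i).eta x)
  | .node t₁ t₂ => fun ℓ x =>
      gaussProd w ℏ t₁ ℓ.1 (x - ℓ.2.2 • toR (mOf w t₁ + mOf w t₂)) *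
      gaussProd w ℏ t₂ ℓ.2.1 (x - ℓ.2.2 • toR (mOf w t₁ + mOf w t₂))

/-- `α_𝒯(x) = -∫_{I_x} (τ^{𝔢₁})^*(α₁) ∧ ⋯ ∧ (τ^{𝔢_k})^*(α_k)`:
the moduli-space integral, as a 1-form (coefficient covector). -/
noncomputable def alpha (w : ι → Wall r) (ℏ : ℝ) (T : Tree ι) (x : Fin r → ℝ) :
    Fin r → ℝ :=
  (-(∫ ℓ in {ℓ : T.Lengths | T.Nonpos ℓ}, T.gaussProd w ℏ ℓ x)) • T.covec w

/-- the truncated integral `α_{𝒯,L}` -/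
noncomputable def alphaTrunc (w : ι → Wall r) (ℏ : ℝ) (T : Tree ι) (L : ℝ)
    (x : Fin r → ℝ) : Fin r → ℝ :=
  (-(∫ ℓ in {ℓ : T.Lengths | T.NonposTrunc L ℓ}, T.gaussProd w ℏ ℓ x)) • T.covec w

end Tree

/-- `W^{-∞}` near a point: all derivatives exponentially small as `ℏ → 0`. -/
def ExpSmallNear {E : Type} [NormedAddCommGroup E] [NormedSpace ℝ E] {r : ℕ}
    (α : ℝ → (Fin r → ℝ) → E) (q : Fin r → ℝ) : Prop :=
  ∃ V ∈ nhds q, ∃ c : ℝ, 0 < c ∧ ∀ j : ℕ, ∃ D : ℝ,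
    ∀ ℏ ∈ Set.Ioc (0:ℝ) 1, ∀ x ∈ V,
      ‖iteratedFDeriv ℝ j (α ℏ) x‖ ≤ D * Real.exp (-c / ℏ)

/-- transversal intersection of (the affine spans of) two polyhedral subsets -/
def Transversal {r : ℕ} (P Q : Set (Fin r → ℝ)) : Prop :=
  (affineSpan ℝ P).direction ⊔ (affineSpan ℝ Q).direction = ⊤

/-- `u^{J⃗_{Γ₁}} ⬝ u^{J⃗_{Γ₂}} ≠ 0` in `R̃_l`: the nilpotent variables
appearing at the incoming edges are pairwise distinct -/
def UsablePair {r : ℕ} {ι : Type} (w : ι → Wall r) (T₁ T₂ : Tree ι) : Prop :=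
  ((T₁.leaves ++ T₂.leaves).map (fun i => (w i).vars)).Pairwise Disjoint

/-- genericity of the perturbed diagram `D̃_{in,l}` -/
def GenericDiagram {r : ℕ} {ι : Type} (w : ι → Wall r) : Prop :=
  ∀ T₁ T₂ : Tree ι, UsablePair w T₁ T₂ →
    (T₁.stops w ∩ T₂.stops w).Nonempty →
    Transversal (T₁.stops w) (T₂.stops w) →
    Module.finrank ℝ (affineSpan ℝ (T₁.stops w ∩ T₂.stops w)).direction = r - 2 ∧
    ¬ (T₁.stops w ∩ T₂.stops w ⊆ intrinsicFrontier ℝ (T₁.stops w)) ∧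
    ¬ (T₁.stops w ∩ T₂.stops w ⊆ intrinsicFrontier ℝ (T₂.stops w))

/-- `ℏ`-dependent `k`-forms on `M_ℝ = Fin r → ℝ`, recorded by their coefficient
functions `ω_{i₁ ⋯ i_k}`. -/
abbrev HForm (r k : ℕ) := ℝ → (Fin r → ℝ) → (Fin k → Fin r) → ℝ

/-- contraction of a `k`-form with `k` vectors -/
def contr {r k : ℕ} (ω : (Fin k → Fin r) → ℝ) (v : Fin k → Fin r → ℝ) : ℝ :=
  ∑ idx : Fin k → Fin r, ω idx * ∏ l, v l (idx l)

/-- a closed tropical polyhedral subset: cut out by finitely many rational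
affine inequalities -/
def IsTropPoly {r : ℕ} (P : Set (Fin r → ℝ)) : Prop :=
  ∃ S : Finset ((Fin r → ℚ) × ℚ),
    P = ⋂ p ∈ S, {x | (∑ i, x i * ((p.1 i : ℝ))) ≤ (p.2 : ℝ)}

/-- the affine data of the codimension-`k` affine subspace containing a
codimension-`k` tropical polyhedral subset: normal covectors `n_i`,
constants, and a dual frame. -/
structure NormalData (r k : ℕ) where
  nrml : Fin k → Fin r → ℝ
  cst : Fin k → ℝ
  dual : Fin k → Fin r → ℝ
  dual_pair : ∀ i j, dotR (dual i) (nrml j) = if i = j then 1 else 0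

/-- affine coordinates transverse to `P`, parametrizing the foliation by
parallel leaves (`x' = 0` on the leaf containing `P`). -/
def NormalData.leafCoord {r k : ℕ} (nd : NormalData r k) (x : Fin r → ℝ) : Fin k → ℝ :=
  fun i => dotR x (nd.nrml i) - nd.cst i

/-- the components of the constant `k`-form `ν_P = n₁ ∧ ⋯ ∧ n_k` normal to `P` -/
noncomputable def NormalData.nu {r k : ℕ} (nd : NormalData r k) : (Fin k → Fin r) → ℝ :=
  fun idx => Matrix.det (Matrix.of fun l l' => nd.nrml l' (idx l))

/-- `α ∈ W^s_P(M_ℝ)`: `α` has asymptotic support on the closed codimension-`k`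
tropical polyhedral subset `P` with weight `s`. -/
def HasAsymSupport {r k : ℕ} (α : HForm r k) (P : Set (Fin r → ℝ))
    (nd : NormalData r k) (s : ℤ) : Prop :=
  IsTropPoly P ∧
  (∀ x ∈ P, nd.leafCoord x = 0) ∧
  -- (1) exponentially small away from P
  (∀ q, q ∉ P → ExpSmallNear α q) ∧
  -- (2) on a neighborhood of P, α = h(x,ℏ) ν_P + (exponentially small)
  (∃ W : Set (Fin r → ℝ), IsOpen W ∧ P ⊆ W ∧
    ∃ h : ℝ → (Fin r → ℝ) → ℝ,
      (∀ ℏ ∈ Set.Ioc (0:ℝ) 1, ContDiff ℝ (⊤ : ℕ∞) (h ℏ)) ∧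
      ∀ q ∈ W, ExpSmallNear (fun ℏ x => (α ℏ x) - (fun idx => h ℏ x * nd.nu idx)) q) ∧
  -- (3) weighted transverse integral estimates controlling the ℏ-order
  (∀ (j : ℕ) (β : Fin k → ℕ), ∃ D : ℝ, ∀ ℏ ∈ Set.Ioc (0:ℝ) 1,
    ∃ g : (Fin k → ℝ) → ℝ,
      (∀ x, ‖iteratedFDeriv ℝ j (fun y => contr (α ℏ y) nd.dual) x‖ ≤
        g (nd.leafCoord x)) ∧
      Integrable (fun t : Fin k → ℝ => (∏ i, |t i| ^ (β i)) * g t) ∧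
      (∫ t : Fin k → ℝ, (∏ i, |t i| ^ (β i)) * g t) ≤
        D * ℏ ^ (-(((j : ℝ) + (s : ℝ) - (∑ i, (β i : ℝ)) - (k : ℝ)) / 2)))

/-- `α ∈ W̃^s_k(M_ℝ)`: a finite sum of forms with asymptotic support of
weight `s` on codimension-`k` tropical polyhedral subsets. -/
def InWtilde {r k : ℕ} (α : HForm r k) (s : ℤ) : Prop :=
  ∃ (n : ℕ) (αs : Fin n → HForm r k) (Ps : Fin n → Set (Fin r → ℝ))
    (nds : Fin n → NormalData r k),
    (∀ ℏ x idx, α ℏ x idx = ∑ a, αs a ℏ x idx) ∧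
    ∀ a, HasAsymSupport (αs a) (Ps a) (nds a) s

/-- the exterior derivative (componentwise) -/
noncomputable def extD {r k : ℕ} (ω : HForm r k) : HForm r (k+1) :=
  fun ℏ x idx => ∑ l : Fin (k+1),
    (-1 : ℝ) ^ (l : ℕ) *
      fderiv ℝ (fun y => ω ℏ y (fun m => idx (l.succAbove m))) x (Pi.single (idx l) 1)

/-- `α ∈ W^s_k(M_ℝ)`: `α ∈ W̃^s_k` and `dα ∈ W̃^{s+1}_{k+1}`. -/
noncomputable def InW {r k : ℕ} (α : HForm r k) (s : ℤ) : Prop :=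
  InWtilde α s ∧ InWtilde (extD α) (s+1)


/-- 1-forms, in the uniform `k`-form representation -/
def toK1 {r : ℕ} (α : ℝ → (Fin r → ℝ) → (Fin r → ℝ)) : HForm r 1 :=
  fun ℏ x idx => α ℏ x (idx 0)


namespace Tree
variable {r : ℕ} {ι : Type}

def numLeaves : Tree ι → ℕ
  | .leaf _ => 1
  | .node t₁ t₂ => numLeaves t₁ + numLeaves t₂

/-- the sign relating the ribbon volume form ν to the canonical coordinate
order of the edge lengths -/
def sgnNu : Tree ι → ℤ
  | .leaf _ => 1
  | .node t₁ t₂ => (-1) ^ numNodes t₂ * sgnNu t₁ * sgnNu t₂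

instance instAddCommGroupLengths : (T : Tree ι) → AddCommGroup T.Lengths
  | .leaf _ => inferInstanceAs (AddCommGroup Unit)
  | .node t₁ t₂ =>
      letI := instAddCommGroupLengths t₁
      letI := instAddCommGroupLengths t₂
      inferInstanceAs (AddCommGroup (Lengths t₁ × Lengths t₂ × ℝ))

/-- the values `η_{i_e}(τ^{𝔢}(s⃗,x))` of the wall functions at the incoming
ends (the map `τ⃗` on the moduli space) -/
def etaFin (w : ι → Wall r) : (T : Tree ι) → T.Lengths → (Fin r → ℝ) → Fin T.numLeaves → ℝ
  | .leaf i, _, x => fun _ => (w i).eta x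
  | .node t₁ t₂, ℓ, x =>
      Fin.append
        (etaFin w t₁ ℓ.1 (x - ℓ.2.2 • toR (mOf w t₁ + mOf w t₂)))
        (etaFin w t₂ ℓ.2.1 (x - ℓ.2.2 • toR (mOf w t₁ + mOf w t₂)))

/-- the canonical basis of the space of edge lengths -/
def basisL : (T : Tree ι) → Fin T.numNodes → T.Lengths
  | .leaf _ => fun a => a.elim0
  | .node t₁ t₂ => Fin.addCases (m := numNodes t₁) (n := numNodes t₂ + 1)
      (fun a => (basisL t₁ a, 0, 0))
      (fun b => Fin.lastCases ((0 : Lengths t₁), (0 : Lengths t₂), (1:ℝ))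
        (fun b' => ((0 : Lengths t₁), basisL t₂ b', (0:ℝ))) b)

end Tree

/-- A marked (ribbon) `k`-tree `𝒥`: one marked incoming edge `ĕ`, carrying an
exponent `φ(𝗆) ∈ M`, joined to the outgoing edge by the core, with labeled
trees grafted onto the core on either side (the ribbon structure). -/
inductive MTree (ι : Type) (r : ℕ) where
  | mleaf : (Fin r → ℤ) → MTree ι r
  | graftL : Tree ι → MTree ι r → MTree ι r
  | graftR : MTree ι r → Tree ι → MTree ι r

namespace MTree
variable {r : ℕ} {ι : Type}

/-- the element of `M` attached to the outgoing (core) edge -/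
def mOfM (w : ι → Wall r) : MTree ι r → Fin r → ℤ
  | .mleaf m => m
  | .graftL L J => Tree.mOf w L + mOfM w J
  | .graftR J L => mOfM w J + Tree.mOf w L

/-- the length `l` of the core -/
def coreLen : MTree ι r → ℕ
  | .mleaf _ => 0
  | .graftL _ J => coreLen J + 1
  | .graftR J _ => coreLen J + 1

def numNodesM : MTree ι r → ℕ
  | .mleaf _ => 0
  | .graftL L J => Tree.numNodes L + numNodesM J + 1
  | .graftR J L => numNodesM J + Tree.numNodes L + 1

/-- the number of unmarked incoming edges -/
def numULeaves : MTree ι r → ℕ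
  | .mleaf _ => 0
  | .graftL L J => Tree.numLeaves L + numULeaves J
  | .graftR J L => numULeaves J + Tree.numLeaves L

/-- the sign `ε_𝒥 = ∏_{i=1}^{l} sgn(⟨-m_{e_{i-1}}, n_{L_i}⟩)` of the marked tree -/
def eps (w : ι → Wall r) : MTree ι r → ℤ
  | .mleaf _ => 1
  | .graftL L J => (pairZ (-(mOfM w J)) (Tree.nOf w L)).sign * eps w J
  | .graftR J L => (pairZ (-(mOfM w J)) (Tree.nOf w L)).sign * eps w J

/-- the sign relating the core-ordered volume form `ν_𝒥` (clockwise grafts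
contributing `ν_{e_{i+1}} = (-1)^{|ν_{e_{i+1}}|} ν_{L_{i+1}} ∧ ν_{e_i} ∧ ds`,
counterclockwise ones `ν_{e_i} ∧ ν_{L_{i+1}} ∧ ds`) to the canonical
coordinate order of the edge lengths -/
def msign (_w : ι → Wall r) : MTree ι r → ℤ
  | .mleaf _ => 1
  | .graftL L J => (-1) ^ (Tree.numNodes L + numNodesM J + 1)
      * Tree.sgnNu L * msign _w J
  | .graftR J L => Tree.sgnNu L * msign _w J

/-- the space of edge lengths -/
def LengthsM : MTree ι r → Type
  | .mleaf _ => Unit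
  | .graftL L J => Tree.Lengths L × LengthsM J × ℝ
  | .graftR J L => LengthsM J × Tree.Lengths L × ℝ

instance instAddCommGroupLengthsM : (J : MTree ι r) → AddCommGroup J.LengthsM
  | .mleaf _ => inferInstanceAs (AddCommGroup Unit)
  | .graftL L J =>
      letI := instAddCommGroupLengthsM J
      inferInstanceAs (AddCommGroup (Tree.Lengths L × LengthsM J × ℝ))
  | .graftR J L =>
      letI := instAddCommGroupLengthsM J
      inferInstanceAs (AddCommGroup (LengthsM J × Tree.Lengths L × ℝ))

noncomputable instance instMeasureSpaceLengthsM : (J : MTree ι r) → MeasureSpace J.LengthsM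
  | .mleaf _ => inferInstanceAs (MeasureSpace Unit)
  | .graftL L J =>
      letI := instMeasureSpaceLengthsM J
      (inferInstance : MeasureSpace (Tree.Lengths L × LengthsM J × ℝ))
  | .graftR J L =>
      letI := instMeasureSpaceLengthsM J
      (inferInstance : MeasureSpace (LengthsM J × Tree.Lengths L × ℝ))

/-- the region `ℝ_{≤0}^{𝒥^{[1]}}` -/
def NonposM : (J : MTree ι r) → J.LengthsM → Prop
  | .mleaf _ => fun _ => True
  | .graftL L J => fun ℓ => Tree.Nonpos L ℓ.1 ∧ NonposM J ℓ.2.1 ∧ ℓ.2.2 ≤ 0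
  | .graftR J L => fun ℓ => NonposM J ℓ.1 ∧ Tree.Nonpos L ℓ.2.1 ∧ ℓ.2.2 ≤ 0

/-- the map `τ⃗`: the values of the wall functions `η_{i_e}` at the unmarked
incoming ends, under the composite flows `τ^{m_e}_s(x) = x - s m_e` -/
def etaFinM (w : ι → Wall r) : (J : MTree ι r) → J.LengthsM → (Fin r → ℝ) → Fin J.numULeaves → ℝ
  | .mleaf _, _, _ => fun j => j.elim0
  | .graftL L J, ℓ, x =>
      Fin.append
        (Tree.etaFin w L ℓ.1 (x - ℓ.2.2 • toR (Tree.mOf w L + mOfM w J)))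
        (etaFinM w J ℓ.2.1 (x - ℓ.2.2 • toR (Tree.mOf w L + mOfM w J)))
  | .graftR J L, ℓ, x =>
      Fin.append
        (etaFinM w J ℓ.1 (x - ℓ.2.2 • toR (mOfM w J + Tree.mOf w L)))
        (Tree.etaFin w L ℓ.2.1 (x - ℓ.2.2 • toR (mOfM w J + Tree.mOf w L)))

/-- the canonical basis of the space of edge lengths -/
def basisLM : (J : MTree ι r) → Fin J.numNodesM → J.LengthsM
  | .mleaf _ => fun a => a.elim0
  | .graftL L J => Fin.addCases (m := Tree.numNodes L) (n := numNodesM J + 1)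
      (fun a => (Tree.basisL L a, 0, 0))
      (fun b => Fin.lastCases ((0 : Tree.Lengths L), (0 : LengthsM J), (1:ℝ))
        (fun b' => ((0 : Tree.Lengths L), basisLM J b', (0:ℝ))) b)
  | .graftR J L => Fin.addCases (m := numNodesM J) (n := Tree.numNodes L + 1)
      (fun a => (basisLM J a, 0, 0))
      (fun b => Fin.lastCases ((0 : LengthsM J), (0 : Tree.Lengths L), (1:ℝ))
        (fun b' => ((0 : LengthsM J), Tree.basisL L b', (0:ℝ))) b)

/-- the locus of stops `P_𝒥` of marked tropical disks of type `𝒥` -/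
def stopsM (w : ι → Wall r) : MTree ι r → Set (Fin r → ℝ)
  | .mleaf _ => Set.univ
  | .graftL L J => {x | ∃ y, (y ∈ Tree.stops w L ∧ y ∈ stopsM w J) ∧
      ∃ t : ℝ, 0 ≤ t ∧ x = y - t • toR (Tree.mOf w L + mOfM w J)}
  | .graftR J L => {x | ∃ y, (y ∈ stopsM w J ∧ y ∈ Tree.stops w L) ∧
      ∃ t : ℝ, 0 ≤ t ∧ x = y - t • toR (mOfM w J + Tree.mOf w L)}

/-- the product of the Gaussian factors at the unmarked incoming edges,
transported by the flows along the tree -/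
noncomputable def gaussProdM (w : ι → Wall r) (ℏ : ℝ) :
    (J : MTree ι r) → J.LengthsM → (Fin r → ℝ) → ℝ
  | .mleaf _ => fun _ _ => 1
  | .graftL L J => fun ℓ x =>
      Tree.gaussProd w ℏ L ℓ.1 (x - ℓ.2.2 • toR (Tree.mOf w L + mOfM w J)) *
      gaussProdM w ℏ J ℓ.2.1 (x - ℓ.2.2 • toR (Tree.mOf w L + mOfM w J))
  | .graftR J L => fun ℓ x =>
      gaussProdM w ℏ J ℓ.1 (x - ℓ.2.2 • toR (mOfM w J + Tree.mOf w L)) *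
      Tree.gaussProd w ℏ L ℓ.2.1 (x - ℓ.2.2 • toR (mOfM w J + Tree.mOf w L))

/-- the (constant) determinant factor of the pullback form
`τ⃗^*(dη_{i_{e₁}} ∧ ⋯ ∧ dη_{i_{e_k}})` contracted with the edge-length
coordinate directions -/
noncomputable def detM (w : ι → Wall r) (J : MTree ι r) : ℝ :=
  Matrix.det (Matrix.of fun (j : Fin J.numULeaves) (l : Fin J.numULeaves) =>
    if h : (l : ℕ) < J.numNodesM then
      etaFinM w J (basisLM J ⟨l, h⟩) 0 j - etaFinM w J 0 0 j
    else 0)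

/-- `α_𝒥(x) = (-1)^l ∫_{I_x} τ⃗^*(dη_{i_{e₁}} ∧ ⋯ ∧ dη_{i_{e_k}})`:
the `ℏ`-dependent function attached to the marked tree -/
noncomputable def alphaM (w : ι → Wall r) (ℏ : ℝ) (J : MTree ι r)
    (x : Fin r → ℝ) : ℝ :=
  (-1 : ℝ) ^ J.coreLen * detM w J *
    ∫ ℓ in {ℓ : J.LengthsM | J.NonposM ℓ}, J.gaussProdM w ℏ ℓ x

end MTree


open Tree MTree

/-- 0-forms (functions) in the uniform representation -/
def toK0 {r : ℕ} (f : ℝ → (Fin r → ℝ) → ℝ) : HForm r 0 :=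
  fun ℏ x _ => f ℏ x

end Scattering16

namespace Scattering16
open MeasureTheory

lemma lin_bound {k : ℕ} (l : (Fin k → ℝ) →L[ℝ] ℝ) (M : ℝ) (hM : ‖l‖ ≤ M) (i : ℕ) (u : Fin k → ℝ) :
    ‖iteratedFDeriv ℝ i (fun y => l y) u‖ ≤ M * (1 + ‖u‖) := by
  have hM0 : 0 ≤ M := (norm_nonneg _).trans hM
  have h1 : M ≤ M * (1 + ‖u‖) := by nlinarith [norm_nonneg u]
  rcases i with _ | _ | i
  · rw [norm_iteratedFDeriv_zero]
    calc ‖l u‖ ≤ ‖l‖ * ‖u‖ := l.le_opNorm u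
      _ ≤ M * ‖u‖ := by gcongr
      _ ≤ _ := by nlinarith
  · rw [zero_add, norm_iteratedFDeriv_one, ContinuousLinearMap.fderiv]
    exact hM.trans h1
  · rw [← norm_iteratedFDeriv_fderiv]
    have : fderiv ℝ (fun y => l y) = fun _ => l := by
      ext1 x; exact l.fderiv
    rw [this, iteratedFDeriv_succ_const]
    simp; positivity

lemma sq_bound {k : ℕ} (l : (Fin k → ℝ) →L[ℝ] ℝ) (M : ℝ) (hM : ‖l‖ ≤ M) (i : ℕ) (u : Fin k → ℝ) :
    ‖iteratedFDeriv ℝ i (fun y => l y * l y) u‖ ≤ 2 ^ i * (M * (1 + ‖u‖)) ^ 2 := by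
  have hc : ContDiff ℝ (⊤ : ℕ∞) (fun y => l y) := l.contDiff
  refine (norm_iteratedFDeriv_mul_le hc hc u (n := i) (by exact_mod_cast le_top)).trans ?_
  have : ∀ a ∈ Finset.range (i+1), ((i.choose a : ℕ) : ℝ) * ‖iteratedFDeriv ℝ a (fun y => l y) u‖ *
      ‖iteratedFDeriv ℝ (i - a) (fun y => l y) u‖ ≤ (i.choose a : ℝ) * (M * (1 + ‖u‖)) ^ 2 := by
    intro a _
    rw [mul_assoc, sq]
    have := lin_bound l M hM a u
    have := lin_bound l M hM (i-a) u
    gcongr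
    exact (norm_nonneg _).trans this
  refine (Finset.sum_le_sum this).trans ?_
  rw [← Finset.sum_mul]
  rw [← Nat.cast_sum, Nat.sum_range_choose]
  push_cast; exact le_rfl

/-- quadratic form -/
noncomputable def Qf {k : ℕ} (T : (Fin k → ℝ) →L[ℝ] (Fin k → ℝ)) (u : Fin k → ℝ) : ℝ :=
  ∑ j, T u j ^ 2

lemma Qf_contDiff {k : ℕ} (T : (Fin k → ℝ) →L[ℝ] (Fin k → ℝ)) : ContDiff ℝ (⊤ : ℕ∞) (fun u => -Qf T u) := by
  unfold Qf
  fun_prop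

lemma Qf_bound {k : ℕ} (T : (Fin k → ℝ) →L[ℝ] (Fin k → ℝ)) : ∃ M : ℝ, 0 ≤ M ∧ ∀ i u,
    ‖iteratedFDeriv ℝ i (fun y => -Qf T y) u‖ ≤ 2 ^ i * M * (1 + ‖u‖) ^ 2 := by
  refine ⟨k * ‖T‖ ^ 2, by positivity, fun i u => ?_⟩
  have h1 : (fun y => -Qf T y) = -(fun y => ∑ j, (fun j y => T y j * T y j) j y) := by
    ext y; simp [Qf, sq]
  rw [h1, iteratedFDeriv_neg_apply, norm_neg]
  have h2 := iteratedFDeriv_sum_apply (𝕜 := ℝ) (f := fun j y => T y j * T y j) (u := Finset.univ) (n := i)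
    (x := u) (fun j _ => by 
      have : ContDiff ℝ i (fun y => T y j * T y j) := by fun_prop
      exact this.contDiffAt)
  rw [show (fun y => ∑ j, (fun j y => T y j * T y j) j y) = (∑ j, fun y => T y j * T y j) from by
    ext y; simp]
  rw [h2]
  refine (norm_sum_le _ _).trans ?_
  have h3 : ∀ j ∈ Finset.univ, ‖iteratedFDeriv ℝ i (fun y => T y j * T y j) u‖ ≤ 2 ^ i * (‖T‖ * (1 + ‖u‖)) ^ 2 := by
    intro j _
    refine sq_bound ((ContinuousLinearMap.proj (R := ℝ) (φ := fun _ : Fin k => ℝ) j).comp T) ‖T‖ ?_ i u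
    refine ContinuousLinearMap.opNorm_le_bound _ (norm_nonneg _) fun x => ?_
    exact (norm_le_pi_norm (T x) j).trans (T.le_opNorm x)
  refine (Finset.sum_le_sum h3).trans ?_
  simp
  apply le_of_eq; ring

noncomputable def fQ {k : ℕ} (T : (Fin k → ℝ) →L[ℝ] (Fin k → ℝ)) (u : Fin k → ℝ) : ℝ :=
  Real.exp (-Qf T u)

lemma fQ_contDiff {k : ℕ} (T : (Fin k → ℝ) →L[ℝ] (Fin k → ℝ)) : ContDiff ℝ (⊤ : ℕ∞) (fQ T) :=
  Real.contDiff_exp.comp (Qf_contDiff T)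

lemma poly_exp (n : ℕ) (δ : ℝ) (hδ : 0 < δ) : ∃ C : ℝ, 0 ≤ C ∧ ∀ t : ℝ, 0 ≤ t →
    (1 + t) ^ n ≤ C * Real.exp (δ * t ^ 2) := by
  -- (1+t) ≤ exp t, so (1+t)^n ≤ exp (n t) ≤ exp (δ t^2 + n^2/(4δ))
  refine ⟨Real.exp (n ^ 2 / (4 * δ)), by positivity, fun t ht => ?_⟩
  have h1 : (1 + t) ^ n ≤ Real.exp (n * t) := by
    rw [Real.exp_nat_mul]
    gcongr
    linarith [Real.add_one_le_exp t]
  refine h1.trans ?_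
  rw [← Real.exp_add]
  apply Real.exp_le_exp.2
  have h2 : (n:ℝ) ^ 2 / (4 * δ) + δ * t ^ 2 - n * t = (n - 2 * δ * t) ^ 2 / (4 * δ) := by
    field_simp; ring
  have h3 : 0 ≤ ((n:ℝ) - 2 * δ * t) ^ 2 / (4 * δ) := by positivity
  linarith

lemma fQ_decay {k : ℕ} (T : (Fin k → ℝ) →L[ℝ] (Fin k → ℝ)) (K : ℝ) (hK : 0 < K)
    (hT : ∀ u, ‖u‖ ≤ K * ‖T u‖) : ∃ c : ℝ, 0 < c ∧ ∀ n : ℕ, ∃ C : ℝ, 0 ≤ C ∧ ∀ u,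
      ‖iteratedFDeriv ℝ n (fQ T) u‖ ≤ C * Real.exp (-c * ‖u‖ ^ 2) := by
  refine ⟨1 / (2 * K ^ 2), by positivity, fun n => ?_⟩
  obtain ⟨M, hM, hMb⟩ := Qf_bound T
  obtain ⟨C, hC, hCb⟩ := poly_exp (2 * n) (1 / (2 * K ^ 2)) (by positivity)
  refine ⟨n.factorial * (2 * (M + 1)) ^ n * C, by positivity, fun u => ?_⟩
  have hQ : ‖u‖ ^ 2 / K ^ 2 ≤ Qf T u := by
    have h1 : ‖T u‖ ^ 2 ≤ Qf T u := by
      have h0 : 0 ≤ Qf T u := Finset.sum_nonneg fun j _ => sq_nonneg _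
      have h : ‖T u‖ ≤ Real.sqrt (Qf T u) := by
        rw [pi_norm_le_iff_of_nonneg (Real.sqrt_nonneg _)]
        intro j
        apply Real.le_sqrt_of_sq_le
        rw [Real.norm_eq_abs, sq_abs]
        exact Finset.single_le_sum (f := fun j => T u j ^ 2) (fun j _ => sq_nonneg _) (Finset.mem_univ j)
      calc ‖T u‖ ^ 2 ≤ Real.sqrt (Qf T u) ^ 2 := by gcongr
        _ = _ := Real.sq_sqrt h0
    have h2 := hT u
    rw [div_le_iff₀ (by positivity)]
    calc ‖u‖ ^ 2 ≤ (K * ‖T u‖) ^ 2 := by gcongr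
      _ = ‖T u‖ ^ 2 * K ^ 2 := by ring
      _ ≤ _ := by gcongr
  have hcomp := norm_iteratedFDeriv_comp_le (𝕜 := ℝ) (g := Real.exp) (f := fun u => -Qf T u) (n := n)
    (N := (⊤ : ℕ∞)) Real.contDiff_exp (Qf_contDiff T) (by exact_mod_cast le_top) u
    (C := Real.exp (-Qf T u)) (D := 2 * (M + 1) * (1 + ‖u‖) ^ 2)
    (fun i _ => by
      rw [norm_iteratedFDeriv_eq_norm_iteratedDeriv, iteratedDeriv_eq_iterate, Real.iter_deriv_exp]
      simp)
    (fun i hi _ => by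
      refine (hMb i u).trans ?_
      rw [mul_pow, mul_pow]
      have h1 : M ≤ (M + 1) ^ i := by
        calc M ≤ (M + 1) := by linarith
          _ ≤ (M+1) ^ i := le_self_pow₀ (by linarith) (by omega)
      have h2 : (1 + ‖u‖) ^ 2 ≤ ((1 + ‖u‖) ^ 2) ^ i := le_self_pow₀ (by nlinarith [norm_nonneg u]) (by omega)
      gcongr)
  refine (show _ from hcomp).trans ?_
  have h5 := hCb ‖u‖ (norm_nonneg _)
  have h6 : Real.exp (-Qf T u) ≤ Real.exp (-(‖u‖ ^ 2 / K ^ 2)) := Real.exp_le_exp.2 (by linarith)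
  calc (n.factorial : ℝ) * Real.exp (-Qf T u) * (2 * (M + 1) * (1 + ‖u‖) ^ 2) ^ n
      = n.factorial * (2 * (M+1)) ^ n * ((1 + ‖u‖) ^ (2 * n) * Real.exp (-Qf T u)) := by
        rw [mul_pow, pow_mul]; ring
    _ ≤ n.factorial * (2 * (M+1)) ^ n * ((C * Real.exp (1 / (2 * K ^ 2) * ‖u‖ ^ 2)) * Real.exp (-(‖u‖ ^ 2 / K ^ 2))) := by
        gcongr
    _ = _ := by
        rw [mul_assoc C, ← Real.exp_add]
        have : 1 / (2 * K ^ 2) * ‖u‖ ^ 2 + -(‖u‖ ^ 2 / K ^ 2) = -(1 / (2 * K ^ 2)) * ‖u‖ ^ 2 := by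
          field_simp; ring
        rw [this]; ring

lemma int_gauss (k : ℕ) (c : ℝ) (hc : 0 < c) : Integrable (fun u : Fin k → ℝ => Real.exp (-c * ‖u‖ ^ 2)) := by
  have h1 : Integrable (fun u : Fin k → ℝ => ∏ i, Real.exp (-(c / (k + 1)) * (u i) ^ 2)) :=
    Integrable.fintype_prod (f := fun _ (v : ℝ) => Real.exp (-(c / (k + 1)) * v ^ 2))
      (fun i => integrable_exp_neg_mul_sq (by positivity))
  refine h1.mono' (by fun_prop) (Filter.Eventually.of_forall fun u => ?_)
  rw [Real.norm_eq_abs, abs_of_pos (Real.exp_pos _), ← Real.exp_sum]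
  apply Real.exp_le_exp.2
  have h2 : ∑ i, u i ^ 2 ≤ k * ‖u‖ ^ 2 := by
    calc ∑ i, u i ^ 2 ≤ ∑ i : Fin k, ‖u‖ ^ 2 := by
          apply Finset.sum_le_sum; intro i _
          have := norm_le_pi_norm u i
          rw [← sq_abs]; gcongr; exact this
      _ = _ := by simp
  rw [← Finset.mul_sum]
  have h3 : c / (k + 1) * ∑ i, u i ^ 2 ≤ c * ‖u‖ ^ 2 := by
    rw [div_mul_eq_mul_div, div_le_iff₀ (by positivity)]
    nlinarith [sq_nonneg ‖u‖, mul_le_mul_of_nonneg_left h2 hc.le, mul_nonneg hc.le (sq_nonneg ‖u‖)]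
  linarith

/-- Gaussian decay of all derivatives -/
def GDecay {k : ℕ} (f : (Fin k → ℝ) → ℝ) (c : ℝ) : Prop :=
  ContDiff ℝ (⊤ : ℕ∞) f ∧ ∀ n : ℕ, ∃ C : ℝ, 0 ≤ C ∧ ∀ u,
      ‖iteratedFDeriv ℝ n f u‖ ≤ C * Real.exp (-c * ‖u‖ ^ 2)

noncomputable def FS {k : ℕ} (f : (Fin k → ℝ) → ℝ) (S : Set (Fin k → ℝ)) (z : Fin k → ℝ) : ℝ :=
  ∫ u in S, f (u + z)

lemma exp_shift {k : ℕ} (c : ℝ) (hc : 0 < c) (u z z0 : Fin k → ℝ) (hz : ‖z - z0‖ ≤ 1) :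
    Real.exp (-c * ‖u + z‖ ^ 2) ≤ Real.exp c * Real.exp (-(c/2) * ‖u + z0‖ ^ 2) := by
  rw [← Real.exp_add]
  apply Real.exp_le_exp.2
  have h1 : ‖u + z0‖ ≤ ‖u + z‖ + 1 := by
    calc ‖u + z0‖ = ‖(u + z) - (z - z0)‖ := by congr 1; abel
      _ ≤ ‖u + z‖ + ‖z - z0‖ := norm_sub_le _ _
      _ ≤ _ := by linarith
  have h2 : ‖u + z0‖ ^ 2 ≤ 2 * ‖u + z‖ ^ 2 + 2 := by
    have := norm_nonneg (u + z0)
    nlinarith [sq_nonneg (‖u+z‖ - 1)]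
  nlinarith

lemma int_isom {X G₁ G₂ : Type*} [MeasurableSpace X] {μ : Measure X} [NormedAddCommGroup G₁] [NormedSpace ℝ G₁]
    [NormedAddCommGroup G₂] [NormedSpace ℝ G₂] [CompleteSpace G₁] [CompleteSpace G₂] (L : G₁ ≃ₗᵢ[ℝ] G₂) {φ : X → G₁}
    (h : Integrable φ μ) : ∫ x, L (φ x) ∂μ = L (∫ x, φ x ∂μ) :=
  ContinuousLinearMap.integral_comp_comm (L.toContinuousLinearEquiv : G₁ →L[ℝ] G₂) h

lemma FS_taylor {k : ℕ} {f : (Fin k → ℝ) → ℝ} {c : ℝ} (hc : 0 < c) (hf : GDecay f c) (S : Set (Fin k → ℝ)) :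
    HasFTaylorSeriesUpTo (⊤ : ℕ∞) (FS f S) (fun z n => ∫ u in S, iteratedFDeriv ℝ n f (u + z)) := by
  obtain ⟨hfc, hfd⟩ := hf
  have hcont : ∀ n, Continuous (iteratedFDeriv ℝ n f) := fun n =>
    hfc.continuous_iteratedFDeriv (by exact_mod_cast le_top)
  have hintg : ∀ n z, Integrable (fun u => iteratedFDeriv ℝ n f (u + z)) (volume.restrict S) := by
    intro n z
    obtain ⟨C, hC, hb⟩ := hfd n
    refine Integrable.restrict ?_
    have := ((int_gauss k c hc).const_mul C).comp_add_right z
    exact this.mono' (((hcont n).comp (by fun_prop)).aestronglyMeasurable) (Filter.Eventually.of_forall fun u => hb _)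
  have hder : ∀ n z, HasFDerivAt (fun z => ∫ u in S, iteratedFDeriv ℝ n f (u + z))
      (∫ u in S, iteratedFDeriv ℝ (n+1) f (u + z)).curryLeft z := by
    intro n z
    obtain ⟨C, hC, hb⟩ := hfd (n+1)
    have hcl : ∀ z, (∫ u in S, iteratedFDeriv ℝ (n+1) f (u + z)).curryLeft
        = ∫ u in S, fderiv ℝ (iteratedFDeriv ℝ n f) (u + z) := by
      intro z
      have := int_isom (G₁ := (Fin k → ℝ) [×(n+1)]→L[ℝ] ℝ) (G₂ := (Fin k → ℝ) →L[ℝ] ((Fin k → ℝ) [×n]→L[ℝ] ℝ))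
        (continuousMultilinearCurryLeftEquiv ℝ (fun _ : Fin (n+1) => (Fin k → ℝ)) ℝ)
        (hintg (n+1) z)
      rw [fderiv_iteratedFDeriv]
      exact this.symm
    rw [hcl]
    refine hasFDerivAt_integral_of_dominated_of_fderiv_le (s := Metric.closedBall z 1)
      (bound := fun u => C * (Real.exp c * Real.exp (-(c/2) * ‖u + z‖ ^ 2)))
      (F' := fun z u => fderiv ℝ (iteratedFDeriv ℝ n f) (u + z))
      (Metric.closedBall_mem_nhds _ one_pos) ?_ (hintg n z) ?_ ?_ ?_ ?_
    · exact Filter.Eventually.of_forall fun z => (hintg n z).1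
    · rw [fderiv_iteratedFDeriv]
      exact ((LinearIsometryEquiv.continuous (continuousMultilinearCurryLeftEquiv ℝ
        (fun _ : Fin (n+1) => (Fin k → ℝ)) ℝ)).comp ((hcont _).comp (by fun_prop))).aestronglyMeasurable
    · refine Filter.Eventually.of_forall fun u z' hz' => ?_
      rw [norm_fderiv_iteratedFDeriv]
      refine (hb _).trans ?_
      have := exp_shift c hc u z' z (by simpa [dist_eq_norm] using hz')
      gcongr
    · have h := (((int_gauss k (c/2) (by positivity)).const_mul (Real.exp c)).const_mul C).comp_add_right z
      exact Integrable.restrict h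
    · refine Filter.Eventually.of_forall fun u z' _ => ?_
      have hd : DifferentiableAt ℝ (iteratedFDeriv ℝ n f) (u + z') :=
        (hfc.differentiable_iteratedFDeriv (m := n) (by exact_mod_cast (WithTop.coe_lt_top n))) _
      exact hd.hasFDerivAt.comp z' ((hasFDerivAt_id z').const_add u)
  refine ⟨fun x => ?_, fun n _ x => hder n x, fun n _ => ?_⟩
  · have h0 : ∀ u, f u = (ContinuousMultilinearMap.apply ℝ (fun _ : Fin 0 => (Fin k → ℝ)) ℝ 0) (iteratedFDeriv ℝ 0 f u) := fun u => rfl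
    unfold FS
    simp_rw [h0]
    rw [ContinuousLinearMap.integral_comp_comm _ (hintg 0 x)]
    rfl
  · exact continuous_iff_continuousAt.2 fun z => (hder n z).continuousAt

lemma FS_contDiff {k : ℕ} {f : (Fin k → ℝ) → ℝ} {c : ℝ} (hc : 0 < c) (hf : GDecay f c) (S : Set (Fin k → ℝ)) :
    ContDiff ℝ (⊤ : ℕ∞) (FS f S) := (FS_taylor hc hf S).contDiff

lemma FS_bound {k : ℕ} {f : (Fin k → ℝ) → ℝ} {c : ℝ} (hc : 0 < c) (hf : GDecay f c) (n : ℕ) :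
    ∃ C : ℝ, 0 ≤ C ∧ ∀ S : Set (Fin k → ℝ), MeasurableSet S → ∀ z, ∀ ρ : ℝ, 0 ≤ ρ → (∀ u ∈ S, ρ ≤ ‖u + z‖) →
      ‖iteratedFDeriv ℝ n (FS f S) z‖ ≤ C * Real.exp (-(c/2) * ρ ^ 2) := by
  obtain ⟨C, hC, hb⟩ := hf.2 n
  refine ⟨C * ∫ u : Fin k → ℝ, Real.exp (-(c/2) * ‖u‖ ^ 2),
    mul_nonneg hC (integral_nonneg fun _ => (Real.exp_pos _).le), fun S hS z ρ hρ hu => ?_⟩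
  rw [← (FS_taylor hc hf S).eq_iteratedFDeriv (m := n) (by exact_mod_cast le_top)]
  have hi : Integrable (fun u : Fin k → ℝ => C * Real.exp (-(c/2) * ρ ^ 2) * Real.exp (-(c/2) * ‖u + z‖ ^ 2)) :=
    ((int_gauss k (c/2) (by positivity)).comp_add_right z).const_mul _
  calc ‖∫ u in S, iteratedFDeriv ℝ n f (u + z)‖
      ≤ ∫ u in S, C * Real.exp (-(c/2) * ρ ^ 2) * Real.exp (-(c/2) * ‖u + z‖ ^ 2) := by
        refine norm_integral_le_of_norm_le hi.restrict ?_
        refine (ae_restrict_mem hS).mono fun u huS => (hb _).trans ?_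
        rw [mul_assoc, ← Real.exp_add]
        have h1 := hu u huS
        have h2 : ρ ^ 2 ≤ ‖u + z‖ ^ 2 := by gcongr
        gcongr
        nlinarith
    _ ≤ ∫ u, C * Real.exp (-(c/2) * ρ ^ 2) * Real.exp (-(c/2) * ‖u + z‖ ^ 2) :=
        setIntegral_le_integral hi (Filter.Eventually.of_forall fun u => by positivity)
    _ = _ := by
        rw [integral_const_mul, integral_add_right_eq_self (fun u : Fin k → ℝ => Real.exp (-(c/2) * ‖u‖ ^ 2))]
        ring

lemma FS_integrable {k : ℕ} {f : (Fin k → ℝ) → ℝ} {c : ℝ} (hc : 0 < c) (hf : GDecay f c) (z : Fin k → ℝ) :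
    Integrable (fun u => f (u + z)) := by
  obtain ⟨C, hC, hb⟩ := hf.2 0
  have := ((int_gauss k c hc).const_mul C).comp_add_right z
  refine this.mono' ((hf.1.continuous.comp (by fun_prop)).aestronglyMeasurable) (Filter.Eventually.of_forall fun u => ?_)
  have := hb (u + z)
  rwa [norm_iteratedFDeriv_zero] at this

end Scattering16

namespace Scattering16
open MeasureTheory

def Orth (k : ℕ) : Set (Fin k → ℝ) := {u | ∀ m, u m ≤ 0}
def ROrth {k : ℕ} (i : Fin k) : Set (Fin k → ℝ) := {u | 0 < u i ∧ ∀ m, m ≠ i → u m ≤ 0}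

lemma Orth_meas (k : ℕ) : MeasurableSet (Orth k) := by
  have : Orth k = ⋂ m, {u | u m ≤ 0} := by ext; simp [Orth]
  rw [this]
  exact MeasurableSet.iInter fun m => measurableSet_le (measurable_pi_apply m) measurable_const

lemma ROrth_meas {k : ℕ} (i : Fin k) : MeasurableSet (ROrth i) := by
  have : ROrth i = {u | 0 < u i} ∩ ⋂ m, ⋂ _ : m ≠ i, {u | u m ≤ 0} := by ext; simp [ROrth]
  rw [this]
  exact (measurableSet_lt measurable_const (measurable_pi_apply i)).inter
    (MeasurableSet.iInter fun m => MeasurableSet.iInter fun _ =>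
      measurableSet_le (measurable_pi_apply m) measurable_const)

lemma FS_dir {k : ℕ} {f : (Fin k → ℝ) → ℝ} {c : ℝ} (hc : 0 < c) (hf : GDecay f c) (i : Fin k) (z : Fin k → ℝ) :
    fderiv ℝ (FS f (Orth k)) z (Pi.single i 1) = - fderiv ℝ (FS f (ROrth i)) z (Pi.single i 1) := by
  have hd1 : DifferentiableAt ℝ (FS f (Orth k)) z := (FS_contDiff hc hf _).differentiable (by simp) z
  have hd2 : DifferentiableAt ℝ (FS f (ROrth i)) z := (FS_contDiff hc hf _).differentiable (by simp) z
  have hdU : DifferentiableAt ℝ (FS f (Orth k ∪ ROrth i)) z := (FS_contDiff hc hf _).differentiable (by simp) z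
  have hsum : FS f (Orth k ∪ ROrth i) = FS f (Orth k) + FS f (ROrth i) := by
    ext z
    have hdisj : Disjoint (Orth k) (ROrth i) := by
      rw [Set.disjoint_left]; rintro u h1 ⟨h2, _⟩
      exact absurd (h1 i) (not_le.2 h2)
    exact setIntegral_union hdisj (ROrth_meas i) (FS_integrable hc hf z).restrict (FS_integrable hc hf z).restrict
  have hU : Orth k ∪ ROrth i = {u | ∀ m, m ≠ i → u m ≤ 0} := by
    ext u
    constructor
    · rintro (h | h) m hm
      · exact h m
      · exact h.2 m hm
    · intro h
      by_cases h0 : u i ≤ 0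
      · left; intro m
        by_cases hm : m = i
        · rw [hm]; exact h0
        · exact h m hm
      · right; exact ⟨not_le.1 h0, h⟩
  have hinv : ∀ t : ℝ, FS f (Orth k ∪ ROrth i) (z + t • Pi.single i 1) = FS f (Orth k ∪ ROrth i) z := by
    intro t
    have hm : MeasurableSet (Orth k ∪ ROrth i) := (Orth_meas k).union (ROrth_meas i)
    unfold FS
    rw [← integral_indicator hm, ← integral_indicator hm]
    rw [← integral_add_right_eq_self _ (t • (Pi.single i 1 : Fin k → ℝ))]
    rw [← integral_add_right_eq_self _ (0 : Fin k → ℝ)]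
    rw [← integral_add_right_eq_self (fun u => (Orth k ∪ ROrth i).indicator (fun u => f (u + z)) u)
      (t • (Pi.single i 1 : Fin k → ℝ) + t • (Pi.single i 1 : Fin k → ℝ))]
    congr 1
    ext u
    have h1 : (u + 0 + t • (Pi.single i 1 : Fin k → ℝ) ∈ Orth k ∪ ROrth i) ↔
      (u + (t • (Pi.single i 1 : Fin k → ℝ) + t • (Pi.single i 1 : Fin k → ℝ)) ∈ Orth k ∪ ROrth i) := by
      rw [hU]
      simp only [Set.mem_ofPred_eq]
      refine forall_congr' fun m => forall_congr' fun hm => ?_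
      simp [hm]
    by_cases h2 : u + (t • (Pi.single i 1 : Fin k → ℝ) + t • (Pi.single i 1 : Fin k → ℝ)) ∈ Orth k ∪ ROrth i
    · rw [Set.indicator_of_mem h2, Set.indicator_of_mem (h1.2 h2)]
      congr 1; abel
    · rw [Set.indicator_of_notMem h2, Set.indicator_of_notMem (fun h => h2 (h1.1 h))]
  have hzero : fderiv ℝ (FS f (Orth k ∪ ROrth i)) z (Pi.single i 1) = 0 := by
    rw [← hdU.lineDeriv_eq_fderiv]
    unfold lineDeriv
    simp_rw [hinv]
    simp
  rw [hsum, fderiv_add hd1 hd2] at hzero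
  have : fderiv ℝ (FS f (Orth k)) z (Pi.single i 1) + fderiv ℝ (FS f (ROrth i)) z (Pi.single i 1) = 0 := hzero
  linarith

noncomputable def GS {k : ℕ} (f : (Fin k → ℝ) → ℝ) (i : Fin k) (z : Fin k → ℝ) : ℝ :=
  fderiv ℝ (FS f (Orth k)) z (Pi.single i 1)

lemma dirD_contDiff {k : ℕ} {F : (Fin k → ℝ) → ℝ} (hF : ContDiff ℝ (⊤ : ℕ∞) F) (v : Fin k → ℝ) :
    ContDiff ℝ (⊤ : ℕ∞) (fun z => fderiv ℝ F z v) :=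
  (hF.fderiv_right (m := (⊤ : ℕ∞)) (by simp)).clm_apply contDiff_const

lemma dirD_bound {k : ℕ} {F : (Fin k → ℝ) → ℝ} (hF : ContDiff ℝ (⊤ : ℕ∞) F) (i : Fin k) (n : ℕ) (z : Fin k → ℝ) :
    ‖iteratedFDeriv ℝ n (fun z => fderiv ℝ F z (Pi.single i 1)) z‖ ≤ ‖iteratedFDeriv ℝ (n+1) F z‖ := by
  have h := norm_iteratedFDeriv_clm_apply_const (𝕜 := ℝ) (f := fderiv ℝ F) (c := (Pi.single i 1 : Fin k → ℝ)) (x := z)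
    (N := (⊤ : ℕ∞)) (n := n)
    (hF.fderiv_right (m := (⊤ : ℕ∞)) (by simp)).contDiffAt (by exact_mod_cast le_top)
  refine h.trans ?_
  rw [norm_iteratedFDeriv_fderiv]
  have : ‖(Pi.single i 1 : Fin k → ℝ)‖ ≤ 1 := by
    rw [Pi.norm_single]; simp
  nlinarith [norm_nonneg (iteratedFDeriv ℝ (n+1) F z)]

lemma GS_contDiff {k : ℕ} {f : (Fin k → ℝ) → ℝ} {c : ℝ} (hc : 0 < c) (hf : GDecay f c) (i : Fin k) :
    ContDiff ℝ (⊤ : ℕ∞) (GS f i) := dirD_contDiff (FS_contDiff hc hf _) _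

lemma FS_bound' {k : ℕ} {f : (Fin k → ℝ) → ℝ} {c : ℝ} (hc : 0 < c) (hf : GDecay f c) (n : ℕ) :
    ∃ C : ℝ, 0 ≤ C ∧ (∀ z, ‖iteratedFDeriv ℝ n (FS f (Orth k)) z‖ ≤ C) ∧
     (∀ z m, z m ≤ 0 → ‖iteratedFDeriv ℝ n (FS f (Orth k)) z‖ ≤ C * Real.exp (-(c/2) * (z m) ^ 2)) ∧
     (∀ z i, 0 ≤ z i → ‖iteratedFDeriv ℝ n (FS f (ROrth i)) z‖ ≤ C * Real.exp (-(c/2) * (z i) ^ 2)) := by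
  obtain ⟨C, hC, h⟩ := FS_bound hc hf n
  refine ⟨C, hC, fun z => ?_, fun z m hm => ?_, fun z i hi => ?_⟩
  · simpa using h _ (Orth_meas k) z 0 le_rfl (fun u _ => norm_nonneg _)
  · have := h _ (Orth_meas k) z |z m| (abs_nonneg _) (fun u hu => by
      refine le_trans ?_ (norm_le_pi_norm (u + z) m)
      have := hu m
      rw [Real.norm_eq_abs, Pi.add_apply, abs_of_nonpos hm, abs_of_nonpos (by linarith)]
      linarith)
    rwa [sq_abs] at this
  · have := h _ (ROrth_meas i) z |z i| (abs_nonneg _) (fun u hu => by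
      refine le_trans ?_ (norm_le_pi_norm (u + z) i)
      have := hu.1
      rw [Real.norm_eq_abs, Pi.add_apply, abs_of_nonneg hi, abs_of_nonneg (by linarith)]
      linarith)
    rwa [sq_abs] at this

lemma GS_bound {k : ℕ} {f : (Fin k → ℝ) → ℝ} {c : ℝ} (hc : 0 < c) (hf : GDecay f c) (n : ℕ) :
    ∃ C : ℝ, 0 ≤ C ∧ (∀ i z, ‖iteratedFDeriv ℝ n (GS f i) z‖ ≤ C * Real.exp (-(c/2) * (z i) ^ 2)) ∧
     (∀ i z m, z m ≤ 0 → ‖iteratedFDeriv ℝ n (GS f i) z‖ ≤ C * Real.exp (-(c/2) * (z m) ^ 2)) := by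
  obtain ⟨C, hC, _, h1, h2⟩ := FS_bound' hc hf (n+1)
  have h3 : ∀ i z m, z m ≤ 0 → ‖iteratedFDeriv ℝ n (GS f i) z‖ ≤ C * Real.exp (-(c/2) * (z m) ^ 2) :=
    fun i z m hm => (dirD_bound (FS_contDiff hc hf _) i n z).trans (h1 z m hm)
  refine ⟨C, hC, fun i z => ?_, h3⟩
  rcases le_total (z i) 0 with hi | hi
  · exact h3 i z i hi
  · have : GS f i = - (fun z => fderiv ℝ (FS f (ROrth i)) z (Pi.single i 1)) := by
      ext z; exact FS_dir hc hf i z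
    rw [this, iteratedFDeriv_neg_apply, norm_neg]
    exact (dirD_bound (FS_contDiff hc hf _) i n z).trans (h2 z i hi)

/-- composition with scaled affine maps -/
lemma scaled_contDiff {r k : ℕ} {Φ : (Fin k → ℝ) → ℝ} (hΦ : ContDiff ℝ (⊤ : ℕ∞) Φ)
    (L : (Fin r → ℝ) →L[ℝ] (Fin k → ℝ)) (y0 : Fin k → ℝ) (a h : ℝ) :
    ContDiff ℝ (⊤ : ℕ∞) (fun x => a * Φ (h • (L x + y0))) := by
  have : ContDiff ℝ (⊤ : ℕ∞) (fun x => h • (L x + y0)) := by fun_prop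
  exact contDiff_const.mul (hΦ.comp this)

lemma scaled_bound {r k : ℕ} {Φ : (Fin k → ℝ) → ℝ} (hΦ : ContDiff ℝ (⊤ : ℕ∞) Φ)
    (L : (Fin r → ℝ) →L[ℝ] (Fin k → ℝ)) (y0 : Fin k → ℝ) (a h : ℝ) (hh : 0 ≤ h) (n : ℕ) (x : Fin r → ℝ) :
    ‖iteratedFDeriv ℝ n (fun x => a * Φ (h • (L x + y0))) x‖ ≤
      |a| * (h * ‖L‖) ^ n * ‖iteratedFDeriv ℝ n Φ (h • (L x + y0))‖ := by
  have e1 : (fun x => a * Φ (h • (L x + y0))) = a • ((fun z => Φ (z + h • y0)) ∘ (h • L)) := by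
    ext x; simp [smul_add]
  have hΨ : ContDiff ℝ (⊤ : ℕ∞) (fun z => Φ (z + h • y0)) := hΦ.comp (by fun_prop)
  have hn : (n : WithTop ℕ∞) ≤ ((⊤ : ℕ∞) : WithTop ℕ∞) := by exact_mod_cast le_top
  rw [e1, iteratedFDeriv_const_smul_apply ((hΨ.comp (h • L).contDiff).of_le hn).contDiffAt, norm_smul, mul_assoc]
  rw [Real.norm_eq_abs]
  refine mul_le_mul_of_nonneg_left ?_ (abs_nonneg _)
  rw [ContinuousLinearMap.iteratedFDeriv_comp_right (h • L) hΨ x hn]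
  refine (ContinuousMultilinearMap.norm_compContinuousLinearMap_le _ _).trans ?_
  rw [iteratedFDeriv_comp_add_right]
  simp only [Finset.prod_const, Finset.card_univ, Fintype.card_fin, norm_smul, Real.norm_eq_abs, abs_of_nonneg hh]
  rw [mul_comm, smul_add]
  rfl

lemma sqrtinv_sq {ℏ : ℝ} (h : 0 < ℏ) : ((Real.sqrt ℏ)⁻¹) ^ 2 = 1 / ℏ := by
  rw [inv_pow, Real.sq_sqrt h.le, one_div]

lemma expsmall_scaled {r k : ℕ} {Φ : (Fin k → ℝ) → ℝ} (hΦ : ContDiff ℝ (⊤ : ℕ∞) Φ)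
    (L : (Fin r → ℝ) →L[ℝ] (Fin k → ℝ)) (y0 : Fin k → ℝ) (a : ℝ) (p : ℕ) (m : Fin k) (c : ℝ) (hc : 0 < c)
    (Pc : (Fin k → ℝ) → Prop)
    (hb : ∀ n, ∃ C : ℝ, 0 ≤ C ∧ ∀ z, Pc z → ‖iteratedFDeriv ℝ n Φ z‖ ≤ C * Real.exp (-c * (z m) ^ 2))
    (q : Fin r → ℝ) (V : Set (Fin r → ℝ)) (hV : V ∈ nhds q) (δ : ℝ) (hδ : 0 < δ)
    (h1 : ∀ x ∈ V, δ ≤ |(L x + y0) m|) (h2 : ∀ x ∈ V, ∀ h : ℝ, 0 < h → Pc (h • (L x + y0))) :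
    ExpSmallNear (fun ℏ x => a * (Real.sqrt ℏ)⁻¹ ^ p * Φ ((Real.sqrt ℏ)⁻¹ • (L x + y0))) q := by
  refine ⟨V, hV, c * δ ^ 2 / 2, by positivity, fun n => ?_⟩
  obtain ⟨C, hC, hCb⟩ := hb n
  obtain ⟨C', hC', hCb'⟩ := poly_exp (p + n) (c * δ ^ 2 / 2) (by positivity)
  refine ⟨|a| * ‖L‖ ^ n * C * C', fun ℏ hℏ x hx => ?_⟩
  have hs : 0 < (Real.sqrt ℏ)⁻¹ := inv_pos.2 (Real.sqrt_pos.2 hℏ.1)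
  have hsq := sqrtinv_sq hℏ.1
  set h := (Real.sqrt ℏ)⁻¹
  refine (scaled_bound hΦ L y0 (a * h ^ p) h hs.le n x).trans ?_
  have h3 := hCb _ (h2 x hx h hs)
  have h4 : Real.exp (-c * ((h • (L x + y0)) m) ^ 2) ≤ Real.exp (-c * (δ ^ 2 * h ^ 2)) := by
    apply Real.exp_le_exp.2
    have : δ ^ 2 ≤ ((L x + y0) m) ^ 2 := by
      rw [← sq_abs ((L x + y0) m)]; have := h1 x hx; gcongr
    have h5 : ((h • (L x + y0)) m) ^ 2 = h ^ 2 * ((L x + y0) m) ^ 2 := by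
      rw [Pi.smul_apply, smul_eq_mul, mul_pow]
    rw [h5]
    have : δ ^ 2 * h ^ 2 ≤ h ^ 2 * ((L x + y0) m) ^ 2 := by
      rw [mul_comm]; gcongr
    nlinarith
  have h5 : h ^ (p + n) ≤ C' * Real.exp (c * δ ^ 2 / 2 * h ^ 2) := by
    refine le_trans ?_ (hCb' h hs.le)
    gcongr; linarith
  rw [abs_mul, abs_of_pos (pow_pos hs p)]
  calc |a| * h ^ p * (h * ‖L‖) ^ n * ‖iteratedFDeriv ℝ n Φ (h • (L x + y0))‖
      ≤ |a| * h ^ p * (h * ‖L‖) ^ n * (C * Real.exp (-c * (δ ^ 2 * h ^ 2))) := by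
        gcongr
        exact h3.trans (by gcongr)
    _ = |a| * ‖L‖ ^ n * C * (h ^ (p + n) * Real.exp (-c * (δ ^ 2 * h ^ 2))) := by
        rw [mul_pow, pow_add]; ring
    _ ≤ |a| * ‖L‖ ^ n * C * ((C' * Real.exp (c * δ ^ 2 / 2 * h ^ 2)) * Real.exp (-c * (δ ^ 2 * h ^ 2))) := by
        gcongr
    _ = _ := by
        rw [mul_assoc C', ← Real.exp_add]
        have : c * δ ^ 2 / 2 * h ^ 2 + -c * (δ ^ 2 * h ^ 2) = -(c * δ ^ 2 / 2) / ℏ := by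
          rw [hsq]; field_simp; ring
        rw [this]; ring

lemma ExpSmallNear.congr {E : Type} [NormedAddCommGroup E] [NormedSpace ℝ E] {r : ℕ}
    {α β : ℝ → (Fin r → ℝ) → E} {q : Fin r → ℝ} (h : ExpSmallNear α q)
    (hab : ∀ ℏ, 0 < ℏ → α ℏ = β ℏ) : ExpSmallNear β q := by
  obtain ⟨V, hV, c, hc, h⟩ := h
  refine ⟨V, hV, c, hc, fun j => ?_⟩
  obtain ⟨D, hD⟩ := h j
  exact ⟨D, fun ℏ hℏ x hx => by rw [← hab ℏ hℏ.1]; exact hD ℏ hℏ x hx⟩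

lemma ExpSmallNear.zero {E : Type} [NormedAddCommGroup E] [NormedSpace ℝ E] {r : ℕ}
    (q : Fin r → ℝ) : ExpSmallNear (fun _ _ => (0 : E)) q := by
  refine ⟨Set.univ, Filter.univ_mem, 1, one_pos, fun j => ⟨0, fun ℏ _ x _ => ?_⟩⟩
  have : iteratedFDeriv ℝ j (fun _ : Fin r → ℝ => (0 : E)) = 0 := iteratedFDeriv_fun_zero
  rw [this]; simp

lemma ExpSmallNear.add {E : Type} [NormedAddCommGroup E] [NormedSpace ℝ E] {r : ℕ}
    {α β : ℝ → (Fin r → ℝ) → E} {q : Fin r → ℝ} (h : ExpSmallNear α q) (h' : ExpSmallNear β q)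
    (ha : ∀ ℏ, 0 < ℏ → ContDiff ℝ (⊤ : ℕ∞) (α ℏ)) (hb : ∀ ℏ, 0 < ℏ → ContDiff ℝ (⊤ : ℕ∞) (β ℏ)) :
    ExpSmallNear (fun ℏ x => α ℏ x + β ℏ x) q := by
  obtain ⟨V, hV, c, hc, h⟩ := h
  obtain ⟨V', hV', c', hc', h'⟩ := h'
  refine ⟨V ∩ V', Filter.inter_mem hV hV', min c c', lt_min hc hc', fun j => ?_⟩
  obtain ⟨D, hD⟩ := h j
  obtain ⟨D', hD'⟩ := h' j
  refine ⟨|D| + |D'|, fun ℏ hℏ x hx => ?_⟩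
  have hn : (j : WithTop ℕ∞) ≤ ((⊤ : ℕ∞) : WithTop ℕ∞) := by exact_mod_cast le_top
  have : iteratedFDeriv ℝ j (fun x => α ℏ x + β ℏ x) x = iteratedFDeriv ℝ j (α ℏ) x + iteratedFDeriv ℝ j (β ℏ) x :=
    iteratedFDeriv_add_apply ((ha ℏ hℏ.1).of_le hn).contDiffAt ((hb ℏ hℏ.1).of_le hn).contDiffAt
  rw [this]
  refine (norm_add_le _ _).trans ?_
  have e1 : Real.exp (-c / ℏ) ≤ Real.exp (-(min c c') / ℏ) := by
    apply Real.exp_le_exp.2; have := hℏ.1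
    gcongr; exact min_le_left _ _
  have e2 : Real.exp (-c' / ℏ) ≤ Real.exp (-(min c c') / ℏ) := by
    apply Real.exp_le_exp.2; have := hℏ.1
    gcongr; exact min_le_right _ _
  rw [add_mul]
  refine add_le_add ((hD ℏ hℏ x hx.1).trans ?_) ((hD' ℏ hℏ x hx.2).trans ?_)
  · calc _ ≤ |D| * Real.exp (-c / ℏ) := by gcongr; exact le_abs_self _
      _ ≤ _ := by gcongr
  · calc _ ≤ |D'| * Real.exp (-c' / ℏ) := by gcongr; exact le_abs_self _
      _ ≤ _ := by gcongr

lemma ExpSmallNear.sum {E : Type} [NormedAddCommGroup E] [NormedSpace ℝ E] {r : ℕ} {κ : Type*} (s : Finset κ)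
    {α : κ → ℝ → (Fin r → ℝ) → E} {q : Fin r → ℝ} (h : ∀ i ∈ s, ExpSmallNear (α i) q)
    (ha : ∀ i, ∀ ℏ, 0 < ℏ → ContDiff ℝ (⊤ : ℕ∞) (α i ℏ)) :
    ExpSmallNear (fun ℏ x => ∑ i ∈ s, α i ℏ x) q := by
  classical
  induction s using Finset.induction_on with
  | empty => simpa using ExpSmallNear.zero q
  | insert i s hi ih =>
    simp_rw [Finset.sum_insert hi]
    refine (h i (Finset.mem_insert_self _ _)).add (ih fun j hj => h j (Finset.mem_insert_of_mem hj)) (ha i) ?_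
    intro ℏ hℏ
    exact ContDiff.sum fun j _ => ha j ℏ hℏ

lemma ExpSmallNear.vec {r : ℕ} {I : Type} [Fintype I] {α : ℝ → (Fin r → ℝ) → ℝ} {q : Fin r → ℝ}
    (h : ExpSmallNear α q) (ha : ∀ ℏ, 0 < ℏ → ContDiff ℝ (⊤ : ℕ∞) (α ℏ)) (ν : I → ℝ) :
    ExpSmallNear (fun ℏ x => (fun i => α ℏ x * ν i : I → ℝ)) q := by
  obtain ⟨V, hV, c, hc, h⟩ := h
  refine ⟨V, hV, c, hc, fun j => ?_⟩
  obtain ⟨D, hD⟩ := h j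
  let T : ℝ →L[ℝ] (I → ℝ) := ContinuousLinearMap.toSpanSingleton ℝ ν
  refine ⟨‖T‖ * D, fun ℏ hℏ x hx => ?_⟩
  have e : (fun x => (fun i => α ℏ x * ν i : I → ℝ)) = T ∘ α ℏ := by
    ext x i; simp [T]
  show ‖iteratedFDeriv ℝ j (fun x => (fun i => α ℏ x * ν i : I → ℝ)) x‖ ≤ _
  rw [e]
  have hn : (j : WithTop ℕ∞) ≤ ((⊤ : ℕ∞) : WithTop ℕ∞) := by exact_mod_cast le_top
  refine (T.norm_iteratedFDeriv_comp_left (ha ℏ hℏ.1).contDiffAt hn).trans ?_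
  rw [mul_assoc]
  exact mul_le_mul_of_nonneg_left (hD ℏ hℏ x hx) (norm_nonneg _)

end Scattering16

namespace Scattering16
open MeasureTheory

def nd0 (r : ℕ) : NormalData r 0 where
  nrml := fun i => i.elim0
  cst := fun i => i.elim0
  dual := fun i => i.elim0
  dual_pair := fun i => i.elim0

lemma hpow (ℏ : ℝ) (h : 0 < ℏ) (j b : ℕ) :
    ((Real.sqrt ℏ)⁻¹) ^ j * (((Real.sqrt ℏ)⁻¹) ^ b)⁻¹ = ℏ ^ (-(((j:ℝ) - b) / 2)) := by
  have h1 : (Real.sqrt ℏ)⁻¹ = ℏ ^ (-(1/2) : ℝ) := by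
    rw [Real.sqrt_eq_rpow, Real.rpow_neg h.le]
  rw [h1, ← Real.rpow_natCast, ← Real.rpow_natCast, ← Real.rpow_mul h.le, ← Real.rpow_mul h.le,
    ← Real.rpow_neg h.le, ← Real.rpow_add h]
  congr 1; ring

lemma asym0 {r : ℕ} {α : ℝ → (Fin r → ℝ) → ℝ} {Q : Set (Fin r → ℝ)} (hQ : IsTropPoly Q)
    (hsm : ∀ q, q ∉ Q → ExpSmallNear α q)
    (hcd : ∀ ℏ, 0 < ℏ → ContDiff ℝ (⊤ : ℕ∞) (α ℏ))
    (hb : ∀ j : ℕ, ∃ D : ℝ, ∀ ℏ ∈ Set.Ioc (0:ℝ) 1, ∀ x, ‖iteratedFDeriv ℝ j (α ℏ) x‖ ≤ D * (Real.sqrt ℏ)⁻¹ ^ j) :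
    HasAsymSupport (toK0 α) Q (nd0 r) 0 := by
  refine ⟨hQ, fun x _ => Subsingleton.elim _ _, fun q hq => ?_, ?_, fun j β => ?_⟩
  · refine ((hsm q hq).vec hcd (fun _ : Fin 0 → Fin r => (1:ℝ))).congr fun ℏ _ => ?_
    ext x i; simp [toK0]
  · refine ⟨Set.univ, isOpen_univ, Set.subset_univ _, α, fun ℏ hℏ => hcd ℏ hℏ.1, fun q _ => ?_⟩
    refine (ExpSmallNear.zero q).congr fun ℏ _ => ?_
    ext x i; simp [toK0, NormalData.nu]
  · obtain ⟨D, hD⟩ := hb j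
    refine ⟨D, fun ℏ hℏ => ⟨fun _ => D * (Real.sqrt ℏ)⁻¹ ^ j, fun x => ?_, ?_, ?_⟩⟩
    · have : (fun y => contr (toK0 α ℏ y) (nd0 r).dual) = α ℏ := by
        ext y; simp [contr, toK0]
      rw [this]; exact hD ℏ hℏ x
    · rw [volume_pi, Measure.pi_of_empty _ (fun i => i.elim0)]
      exact integrable_dirac enorm_lt_top
    · rw [volume_pi, Measure.pi_of_empty _ (fun i => i.elim0), integral_dirac]
      have := hpow ℏ hℏ.1 j 0
      simp at this ⊢
      rw [this]

lemma gint (c : ℝ) (hc : 0 < c) (b : ℕ) : Integrable (fun s : ℝ => |s| ^ b * Real.exp (-c * s ^ 2)) := by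
  have h := (integrable_rpow_mul_exp_neg_mul_sq hc (s := (b : ℝ)) (by
    have : (0:ℝ) ≤ b := Nat.cast_nonneg b
    linarith)).norm
  refine h.congr (Filter.Eventually.of_forall fun s => ?_)
  simp [abs_of_pos (Real.exp_pos _)]

lemma gint2 (c : ℝ) (hc : 0 < c) (b : ℕ) (h : ℝ) (hh : 0 < h) (a : ℝ) :
    Integrable (fun t : Fin 1 → ℝ => |t 0| ^ b * (a * Real.exp (-c * (h * t 0) ^ 2))) ∧
    (∫ t : Fin 1 → ℝ, |t 0| ^ b * (a * Real.exp (-c * (h * t 0) ^ 2))) =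
      a * (h⁻¹ * (h ^ b)⁻¹) * ∫ s : ℝ, |s| ^ b * Real.exp (-c * s ^ 2) := by
  have mp := volume_preserving_funUnique (Fin 1) ℝ
  have e : ∀ s : ℝ, |s| ^ b * (a * Real.exp (-c * (h * s) ^ 2)) =
      a * (h ^ b)⁻¹ * (|h * s| ^ b * Real.exp (-c * (h * s) ^ 2)) := by
    intro s
    rw [abs_mul, abs_of_pos hh, mul_pow h |s| b]
    have : h ^ b ≠ 0 := by positivity
    have h2 : (h ^ b)⁻¹ * h ^ b = 1 := inv_mul_cancel₀ this
    generalize Real.exp (-c * (h * s) ^ 2) = E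
    linear_combination (-(a * |s| ^ b * E)) * h2
  have hi : Integrable (fun s : ℝ => |s| ^ b * (a * Real.exp (-c * (h * s) ^ 2))) := by
    simp_rw [e]
    exact ((gint c hc b).comp_mul_left' hh.ne').const_mul _
  constructor
  · exact (mp.integrable_comp_emb (MeasurableEquiv.measurableEmbedding _)).2 hi
  · have := mp.integral_comp' (g := fun s : ℝ => |s| ^ b * (a * Real.exp (-c * (h * s) ^ 2)))
    refine (show _ = _ from this).trans ?_
    simp_rw [e]
    rw [integral_const_mul, Measure.integral_comp_mul_left (fun s : ℝ => |s| ^ b * Real.exp (-c * s ^ 2)),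
      abs_of_pos (inv_pos.2 hh), smul_eq_mul]
    ring

noncomputable def nd1 {r : ℕ} (n : Fin r → ℝ) (c : ℝ) (hn : n ≠ 0) : NormalData r 1 where
  nrml := fun _ => n
  cst := fun _ => c
  dual := fun _ => (dotR n n)⁻¹ • n
  dual_pair := fun i j => by
    have h0 : dotR n n ≠ 0 := by
      intro h
      apply hn
      ext p
      have := (Finset.sum_eq_zero_iff_of_nonneg (fun i _ => mul_self_nonneg (n i))).1 h p (Finset.mem_univ p)
      simpa using this
    rw [if_pos (Subsingleton.elim i j)]
    have : dotR ((dotR n n)⁻¹ • n) n = (dotR n n)⁻¹ * dotR n n := by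
      unfold dotR; simp only [Pi.smul_apply, smul_eq_mul, mul_assoc]; rw [← Finset.mul_sum]
    rw [this]; exact inv_mul_cancel₀ h0

lemma asym1 {r : ℕ} {a : ℝ → (Fin r → ℝ) → ℝ} {Q : Set (Fin r → ℝ)} (hQ : IsTropPoly Q)
    (n : Fin r → ℝ) (cst : ℝ) (hn : n ≠ 0) (hQn : ∀ x ∈ Q, dotR x n - cst = 0)
    (hsm : ∀ q, q ∉ Q → ExpSmallNear a q)
    (hcd : ∀ ℏ, 0 < ℏ → ContDiff ℝ (⊤ : ℕ∞) (a ℏ)) (c : ℝ) (hc : 0 < c)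
    (hb : ∀ j : ℕ, ∃ D : ℝ, ∀ ℏ ∈ Set.Ioc (0:ℝ) 1, ∀ x, ‖iteratedFDeriv ℝ j (a ℏ) x‖ ≤
      D * (Real.sqrt ℏ)⁻¹ ^ (j + 1) * Real.exp (-c * ((Real.sqrt ℏ)⁻¹ * (dotR x n - cst)) ^ 2)) :
    HasAsymSupport (fun ℏ x (idx : Fin 1 → Fin r) => a ℏ x * n (idx 0)) Q (nd1 n cst hn) 1 := by
  have hnu : ∀ idx, (nd1 n cst hn).nu idx = n (idx 0) := by
    intro idx; simp [NormalData.nu, nd1]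
  refine ⟨hQ, fun x hx => funext fun _ => hQn x hx, fun q hq => (hsm q hq).vec hcd _, ?_, fun j β => ?_⟩
  · refine ⟨Set.univ, isOpen_univ, Set.subset_univ _, a, fun ℏ hℏ => hcd ℏ hℏ.1, fun q _ => ?_⟩
    refine (ExpSmallNear.zero q).congr fun ℏ _ => ?_
    ext x i; simp [hnu]
  · obtain ⟨D, hD⟩ := hb j
    refine ⟨D * ∫ s : ℝ, |s| ^ (β 0) * Real.exp (-c * s ^ 2), fun ℏ hℏ => ?_⟩
    have hs : 0 < (Real.sqrt ℏ)⁻¹ := inv_pos.2 (Real.sqrt_pos.2 hℏ.1)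
    have hp := hpow ℏ hℏ.1 j (β 0)
    set h := (Real.sqrt ℏ)⁻¹
    obtain ⟨g1, g2⟩ := gint2 c hc (β 0) h hs (D * h ^ (j+1))
    refine ⟨fun t => D * h ^ (j+1) * Real.exp (-c * (h * t 0) ^ 2), fun x => ?_, ?_, ?_⟩
    · have : (fun y => contr (fun idx : Fin 1 → Fin r => a ℏ y * n (idx 0)) (nd1 n cst hn).dual) = a ℏ := by
        ext y
        have h1 := (nd1 n cst hn).dual_pair 0 0
        rw [if_pos rfl] at h1
        unfold contr
        simp only [Finset.univ_unique, Finset.prod_singleton, Fin.default_eq_zero]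
        rw [← (Equiv.funUnique (Fin 1) (Fin r)).symm.sum_comp]
        simp only [mul_assoc]
        rw [← Finset.mul_sum]
        have h2 : (∑ p, n (((Equiv.funUnique (Fin 1) (Fin r)).symm p) 0) * (nd1 n cst hn).dual 0 (((Equiv.funUnique (Fin 1) (Fin r)).symm p) 0)) = dotR ((nd1 n cst hn).dual 0) ((nd1 n cst hn).nrml 0) := by
          unfold dotR
          refine Finset.sum_congr rfl fun p _ => ?_
          simp [nd1, mul_comm]
        rw [h2, h1, mul_one]
      rw [this]; exact hD ℏ hℏ x
    · simpa using g1
    · simp only [Finset.univ_unique, Finset.prod_singleton, Fin.default_eq_zero, Finset.sum_singleton]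
      rw [g2]
      have : (-(((j:ℝ) + ((1:ℤ):ℝ) - (β 0 : ℝ) - ((1:ℕ):ℝ)) / 2)) = -(((j:ℝ) - β 0)/2) := by push_cast; ring
      rw [this, ← hp]
      apply le_of_eq
      field_simp
      try ring

end Scattering16

namespace Scattering16
open MeasureTheory

lemma tropUniv (r : ℕ) : IsTropPoly (Set.univ : Set (Fin r → ℝ)) := ⟨∅, by simp⟩

lemma nhds_neg {r k : ℕ} (L : (Fin r → ℝ) →L[ℝ] (Fin k → ℝ)) (y0 : Fin k → ℝ) (q : Fin r → ℝ) (m : Fin k)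
    (h : (L q + y0) m < 0) : ∃ V ∈ nhds q, ∃ δ : ℝ, 0 < δ ∧ ∀ x ∈ V, (L x + y0) m ≤ -δ := by
  refine ⟨{x | (L x + y0) m < (L q + y0) m / 2}, ?_, -((L q + y0) m / 2), by linarith, fun x hx => ?_⟩
  · refine IsOpen.mem_nhds (isOpen_lt (by fun_prop) continuous_const) ?_
    simp only [Set.mem_ofPred_eq]; linarith
  · simp only [Set.mem_ofPred_eq] at hx; linarith

lemma nhds_ne {r k : ℕ} (L : (Fin r → ℝ) →L[ℝ] (Fin k → ℝ)) (y0 : Fin k → ℝ) (q : Fin r → ℝ) (m : Fin k)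
    (h : (L q + y0) m ≠ 0) : ∃ V ∈ nhds q, ∃ δ : ℝ, 0 < δ ∧ ∀ x ∈ V, δ ≤ |(L x + y0) m| := by
  have h' := abs_pos.2 h
  refine ⟨{x | |(L q + y0) m| / 2 < |(L x + y0) m|}, ?_, |(L q + y0) m| / 2, by linarith, fun x hx => ?_⟩
  · refine IsOpen.mem_nhds (isOpen_lt continuous_const (by fun_prop)) ?_
    simp only [Set.mem_ofPred_eq]; linarith
  · simp only [Set.mem_ofPred_eq] at hx; linarith

section core
variable {r k : ℕ} {f : (Fin k → ℝ) → ℝ} {c : ℝ} (hc : 0 < c) (hf : GDecay f c)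
  (L : (Fin r → ℝ) →L[ℝ] (Fin k → ℝ)) (y0 : Fin k → ℝ) (κ : ℝ)

lemma core_small_FS (hc : 0 < c) (hf : GDecay f c) (q : Fin r → ℝ) (m : Fin k) (h : (L q + y0) m < 0) :
    ExpSmallNear (fun ℏ x => κ * FS f (Orth k) ((Real.sqrt ℏ)⁻¹ • (L x + y0))) q := by
  obtain ⟨V, hV, δ, hδ, hVδ⟩ := nhds_neg L y0 q m h
  refine (expsmall_scaled (FS_contDiff hc hf (Orth k)) L y0 κ 0 m (c/2) (by positivity) (fun z => z m ≤ 0) ?_ q V hV δ hδ ?_ ?_).congr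
    (fun ℏ _ => by simp)
  · intro n
    obtain ⟨C, hC, _, h1, _⟩ := FS_bound' hc hf n
    exact ⟨C, hC, fun z hz => h1 z m hz⟩
  · intro x hx; rw [abs_of_neg (by linarith [hVδ x hx])]; linarith [hVδ x hx]
  · intro x hx h hh
    have := hVδ x hx
    simp only [Pi.smul_apply, smul_eq_mul]
    exact mul_nonpos_of_nonneg_of_nonpos hh.le (by linarith)

lemma core_small_GS (hc : 0 < c) (hf : GDecay f c) (i : Fin k) (q : Fin r → ℝ)
    (h : (∃ m, (L q + y0) m < 0) ∨ (L q + y0) i ≠ 0) :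
    ExpSmallNear (fun ℏ x => κ * (Real.sqrt ℏ)⁻¹ ^ 1 * GS f i ((Real.sqrt ℏ)⁻¹ • (L x + y0))) q := by
  rcases h with ⟨m, h⟩ | h
  · obtain ⟨V, hV, δ, hδ, hVδ⟩ := nhds_neg L y0 q m h
    refine expsmall_scaled (GS_contDiff hc hf i) L y0 κ 1 m (c/2) (by positivity) (fun z => z m ≤ 0) ?_ q V hV δ hδ ?_ ?_
    · intro n
      obtain ⟨C, hC, _, h1⟩ := GS_bound hc hf n
      exact ⟨C, hC, fun z hz => h1 i z m hz⟩
    · intro x hx; rw [abs_of_neg (by linarith [hVδ x hx])]; linarith [hVδ x hx]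
    · intro x hx h hh
      have := hVδ x hx
      simp only [Pi.smul_apply, smul_eq_mul]
      exact mul_nonpos_of_nonneg_of_nonpos hh.le (by linarith)
  · obtain ⟨V, hV, δ, hδ, hVδ⟩ := nhds_ne L y0 q i h
    refine expsmall_scaled (GS_contDiff hc hf i) L y0 κ 1 i (c/2) (by positivity) (fun z => True) ?_ q V hV δ hδ hVδ ?_
    · intro n
      obtain ⟨C, hC, h1, _⟩ := GS_bound hc hf n
      exact ⟨C, hC, fun z hz => h1 i z⟩
    · intros; trivial

lemma core_FS_bd (hc : 0 < c) (hf : GDecay f c) (j : ℕ) : ∃ D : ℝ, ∀ ℏ ∈ Set.Ioc (0:ℝ) 1, ∀ x,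
    ‖iteratedFDeriv ℝ j (fun x => κ * FS f (Orth k) ((Real.sqrt ℏ)⁻¹ • (L x + y0))) x‖ ≤ D * (Real.sqrt ℏ)⁻¹ ^ j := by
  obtain ⟨C, hC, h0, _, _⟩ := FS_bound' hc hf j
  refine ⟨|κ| * ‖L‖ ^ j * C, fun ℏ hℏ x => ?_⟩
  have hs : 0 ≤ (Real.sqrt ℏ)⁻¹ := inv_nonneg.2 (Real.sqrt_nonneg _)
  refine (scaled_bound (FS_contDiff hc hf _) L y0 κ _ hs j x).trans ?_
  refine (mul_le_mul_of_nonneg_left (h0 _) (by positivity)).trans (le_of_eq ?_)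
  rw [mul_pow]; ring

lemma core_GS_bd (hc : 0 < c) (hf : GDecay f c) (i : Fin k) (j : ℕ) : ∃ D : ℝ, ∀ ℏ ∈ Set.Ioc (0:ℝ) 1, ∀ x,
    ‖iteratedFDeriv ℝ j (fun x => κ * (Real.sqrt ℏ)⁻¹ ^ 1 * GS f i ((Real.sqrt ℏ)⁻¹ • (L x + y0))) x‖ ≤
      D * (Real.sqrt ℏ)⁻¹ ^ (j+1) * Real.exp (-(c/2) * ((Real.sqrt ℏ)⁻¹ * (L x + y0) i) ^ 2) := by
  obtain ⟨C, hC, h0, _⟩ := GS_bound hc hf j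
  refine ⟨|κ| * ‖L‖ ^ j * C, fun ℏ hℏ x => ?_⟩
  have hs : 0 ≤ (Real.sqrt ℏ)⁻¹ := inv_nonneg.2 (Real.sqrt_nonneg _)
  refine (scaled_bound (GS_contDiff hc hf i) L y0 _ _ hs j x).trans ?_
  refine (mul_le_mul_of_nonneg_left (h0 i _) (by positivity)).trans (le_of_eq ?_)
  rw [mul_pow, abs_mul, abs_of_nonneg (pow_nonneg hs 1)]
  simp only [Pi.smul_apply, smul_eq_mul]
  ring

/-- covector of the i-th component -/
noncomputable def cov (L : (Fin r → ℝ) →L[ℝ] (Fin k → ℝ)) (i : Fin k) : Fin r → ℝ := fun p => L (Pi.single p 1) i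

lemma dot_cov (x : Fin r → ℝ) (i : Fin k) : dotR x (cov L i) = L x i := by
  have h : x = ∑ p, x p • (Pi.single p (1:ℝ) : Fin r → ℝ) := by
    ext q; simp [Finset.sum_apply, Pi.single_apply]
  conv_rhs => rw [h]
  simp [map_sum, dotR, cov, Finset.sum_apply]

lemma core_extD (hc : 0 < c) (hf : GDecay f c) (α : ℝ → (Fin r → ℝ) → ℝ)
    (h1 : ∀ ℏ, 0 < ℏ → α ℏ = fun x => κ * FS f (Orth k) ((Real.sqrt ℏ)⁻¹ • (L x + y0)))
    (h2 : ∀ ℏ, ℏ ≤ 0 → ∃ a, α ℏ = fun _ => a) (ℏ : ℝ) (x : Fin r → ℝ) (idx : Fin 1 → Fin r) :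
    extD (toK0 α) ℏ x idx = ∑ i, (κ * (Real.sqrt ℏ)⁻¹ ^ 1 * GS f i ((Real.sqrt ℏ)⁻¹ • (L x + y0))) * cov L i (idx 0) := by
  have e : extD (toK0 α) ℏ x idx = fderiv ℝ (α ℏ) x (Pi.single (idx 0) 1) := by
    simp [extD, toK0]
  rw [e]
  rcases le_or_gt ℏ 0 with h | h
  · obtain ⟨a, ha⟩ := h2 ℏ h
    rw [ha, Real.sqrt_eq_zero_of_nonpos h]
    simp
  · rw [h1 ℏ h]
    set s := (Real.sqrt ℏ)⁻¹
    have hF : Differentiable ℝ (FS f (Orth k)) := (FS_contDiff hc hf _).differentiable (by simp)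
    have hA : HasFDerivAt (fun x => s • (L x + y0)) (s • L) x := by
      exact ((L.hasFDerivAt).add_const y0).const_smul s
    have := (((hF (s • (L x + y0))).hasFDerivAt.comp x hA).const_mul κ).fderiv
    simp only [Function.comp_def] at this
    rw [this]
    simp only [smul_apply, ContinuousLinearMap.comp_apply, smul_eq_mul, map_smul, pow_one]
    set v := L (Pi.single (idx 0) 1) with hv
    have h : v = ∑ p, v p • (Pi.single p (1:ℝ) : Fin k → ℝ) := by
      ext q; simp [Finset.sum_apply, Pi.single_apply]
    conv_lhs => rw [h]
    simp only [map_sum, map_smul, smul_eq_mul, GS, cov]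
    rw [Finset.mul_sum, Finset.mul_sum]
    refine Finset.sum_congr rfl fun p _ => ?_
    rw [← hv]; ring

end core

def CoreConcl {r : ℕ} (α : ℝ → (Fin r → ℝ) → ℝ) (P : Set (Fin r → ℝ)) : Prop :=
  ((∃ nd : NormalData r 0, HasAsymSupport (toK0 α) P nd 0) ∧ InW (toK0 α) 0 ∧ (∀ q, q ∉ P → ExpSmallNear α q)) ∧
  ∃ (nC : ℕ) (cells : Fin nC → Set (Fin r → ℝ)),
        (∀ a, IsTropPoly (cells a) ∧ cells a ⊆ P ∧
          Module.finrank ℝ (affineSpan ℝ (cells a)).direction ≤ r - 1) ∧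
        (∀ q, q ∉ ⋃ a, cells a → ExpSmallNear (fun ℏ x => extD (toK0 α) ℏ x) q)

lemma dim_cell {r : ℕ} (n : Fin r → ℝ) (hn : n ≠ 0) (b : ℝ) (Q : Set (Fin r → ℝ)) (hQ : ∀ x ∈ Q, dotR x n = b) :
    Module.finrank ℝ (affineSpan ℝ Q).direction ≤ r - 1 := by
  let φ : Module.Dual ℝ (Fin r → ℝ) :=
    { toFun := fun x => dotR x n
      map_add' := fun x y => by simp [dotR, add_mul, Finset.sum_add_distrib]
      map_smul' := fun a x => by simp [dotR, Finset.mul_sum, mul_assoc] }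
  have hφ : φ ≠ 0 := by
    intro h
    apply hn; ext p
    have := LinearMap.congr_fun h (Pi.single p 1)
    simpa [φ, dotR, Pi.single_apply] using this
  have h1 := Module.Dual.finrank_ker_add_one_of_ne_zero hφ
  have h2 : (affineSpan ℝ Q).direction ≤ LinearMap.ker φ := by
    rw [direction_affineSpan, vectorSpan_def, Submodule.span_le]
    rintro v ⟨x, hx, y, hy, rfl⟩
    simp only [SetLike.mem_coe, LinearMap.mem_ker, vsub_eq_sub, map_sub]
    show dotR x n - dotR y n = 0
    rw [hQ x hx, hQ y hy, sub_self]
  have h3 := Submodule.finrank_mono h2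
  simp at h1
  omega

theorem core_main {r k : ℕ} {f : (Fin k → ℝ) → ℝ} {c : ℝ} (hc : 0 < c) (hf : GDecay f c)
    (L : (Fin r → ℝ) →L[ℝ] (Fin k → ℝ)) (y0 : Fin k → ℝ) (κ : ℝ) (α : ℝ → (Fin r → ℝ) → ℝ)
    (h1 : ∀ ℏ, 0 < ℏ → α ℏ = fun x => κ * FS f (Orth k) ((Real.sqrt ℏ)⁻¹ • (L x + y0)))
    (h2 : ∀ ℏ, ℏ ≤ 0 → ∃ a, α ℏ = fun _ => a) (P : Set (Fin r → ℝ))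
    (hP : ∀ x, x ∈ P ↔ ∀ m, 0 ≤ (L x + y0) m) (hPt : IsTropPoly P)
    (hPi : ∀ i, IsTropPoly (P ∩ {x | (L x + y0) i = 0})) : CoreConcl α P := by
  have hcd : ∀ ℏ, 0 < ℏ → ContDiff ℝ (⊤ : ℕ∞) (α ℏ) := fun ℏ h => by
    rw [h1 ℏ h]; exact scaled_contDiff (FS_contDiff hc hf _) L y0 _ _
  have hsm : ∀ q, q ∉ P → ExpSmallNear α q := fun q hq => by
    rw [hP] at hq; push Not at hq
    obtain ⟨m, hm⟩ := hq
    exact (core_small_FS L y0 κ hc hf q m hm).congr fun ℏ h => (h1 ℏ h).symm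
  have has : HasAsymSupport (toK0 α) P (nd0 r) 0 := by
    refine asym0 hPt hsm hcd fun j => ?_
    obtain ⟨D, hD⟩ := core_FS_bd L y0 κ hc hf j
    exact ⟨D, fun ℏ hℏ x => by rw [h1 ℏ hℏ.1]; exact hD ℏ hℏ x⟩
  classical
  let I := {i : Fin k // cov L i ≠ 0}
  let e : I ≃ Fin (Fintype.card I) := Fintype.equivFin I
  let a : Fin k → ℝ → (Fin r → ℝ) → ℝ := fun i ℏ x => κ * (Real.sqrt ℏ)⁻¹ ^ 1 * GS f i ((Real.sqrt ℏ)⁻¹ • (L x + y0))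
  let cells : Fin (Fintype.card I) → Set (Fin r → ℝ) := fun b => P ∩ {x | (L x + y0) (e.symm b).1 = 0}
  have hext : ∀ ℏ x idx, extD (toK0 α) ℏ x idx = ∑ b, a (e.symm b).1 ℏ x * cov L (e.symm b).1 (idx 0) := by
    intro ℏ x idx
    rw [core_extD L y0 κ hc hf α h1 h2, e.symm.sum_comp (fun i : I => a i.1 ℏ x * cov L i.1 (idx 0))]
    rw [← Finset.sum_subtype (Finset.univ.filter fun i => cov L i ≠ 0) (by simp) (fun i => a i ℏ x * cov L i (idx 0))]
    symm
    apply Finset.sum_filter_of_ne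
    intro i _ hne h0
    exact hne (by rw [h0]; simp)
  have hacd : ∀ i ℏ, 0 < ℏ → ContDiff ℝ (⊤ : ℕ∞) (a i ℏ) := fun i ℏ h =>
    scaled_contDiff (GS_contDiff hc hf i) L y0 _ _
  have hasm : ∀ i q, q ∉ P ∩ {x | (L x + y0) i = 0} → ExpSmallNear (a i) q := by
    intro i q hq
    refine core_small_GS L y0 κ hc hf i q ?_
    by_cases hqP : q ∈ P
    · exact Or.inr fun h => hq ⟨hqP, h⟩
    · rw [hP] at hqP; push Not at hqP; exact Or.inl hqP
  have hdot : ∀ x i, dotR x (cov L i) - (-y0 i) = (L x + y0) i := fun x i => by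
    rw [dot_cov]; simp
  refine ⟨⟨⟨_, has⟩, ⟨⟨1, fun _ => toK0 α, fun _ => P, fun _ => nd0 r, fun ℏ x idx => by simp, fun _ => has⟩,
    ⟨_, fun b ℏ x idx => a (e.symm b).1 ℏ x * cov L (e.symm b).1 (idx 0), cells,
      fun b => nd1 (cov L (e.symm b).1) (-y0 (e.symm b).1) (e.symm b).2, hext, fun b => ?_⟩⟩, hsm⟩, ?_⟩
  · have := asym1 (a := a (e.symm b).1) (hPi (e.symm b).1) (cov L (e.symm b).1) (-y0 (e.symm b).1) (e.symm b).2
      (fun x hx => by rw [hdot]; exact hx.2) (hasm _) (hacd _) (c/2) (by positivity) (fun j => by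
        simp only [hdot]
        exact core_GS_bd L y0 κ hc hf (e.symm b).1 j)
    exact this
  · refine ⟨_, cells, fun b => ⟨hPi _, Set.inter_subset_left, ?_⟩, fun q hq => ?_⟩
    · refine dim_cell (cov L (e.symm b).1) (e.symm b).2 (-y0 (e.symm b).1) _ fun x hx => ?_
      have := hdot x (e.symm b).1
      rw [hx.2] at this; linarith
    · have hs := ExpSmallNear.sum (q := q) (Finset.univ : Finset (Fin (Fintype.card I)))
        (α := fun b ℏ x => (fun idx : Fin 1 → Fin r => a (e.symm b).1 ℏ x * cov L (e.symm b).1 (idx 0)))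
        (fun b _ => (hasm _ q fun h => hq (Set.mem_iUnion.2 ⟨b, h⟩)).vec (hacd _) _)
        (fun b ℏ h => contDiff_pi.2 fun idx => (hacd _ ℏ h).mul contDiff_const)
      refine hs.congr fun ℏ _ => ?_
      ext x idx
      rw [hext, Finset.sum_apply]

theorem core_zero {r : ℕ} (α : ℝ → (Fin r → ℝ) → ℝ) (hα : ∀ ℏ x, α ℏ x = 0) (P : Set (Fin r → ℝ)) (hPt : IsTropPoly P) :
    CoreConcl α P := by
  obtain rfl : α = fun _ _ => 0 := by ext; simp [hα]
  have hd : ∀ (ℏ x idx), extD (toK0 (fun (_:ℝ) (_ : Fin r → ℝ) => (0:ℝ))) ℏ x idx = 0 := by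
    intro ℏ x idx; simp [extD, toK0]
  refine ⟨⟨⟨nd0 r, asym0 hPt (fun q _ => ExpSmallNear.zero q) (fun _ _ => contDiff_const) fun j => ⟨0, fun ℏ _ x => ?_⟩⟩,
    ⟨⟨0, fun b => b.elim0, fun b => b.elim0, fun b => b.elim0, fun ℏ x idx => by simp [toK0], fun b => b.elim0⟩,
     ⟨0, fun b => b.elim0, fun b => b.elim0, fun b => b.elim0, fun ℏ x idx => by simp [hd], fun b => b.elim0⟩⟩,
    fun q _ => ExpSmallNear.zero q⟩,
    ⟨0, fun b => b.elim0, fun b => b.elim0, fun q _ => (ExpSmallNear.zero q).congr fun ℏ _ => ?_⟩⟩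
  · have : iteratedFDeriv ℝ j (fun _ : Fin r → ℝ => (0 : ℝ)) = 0 := iteratedFDeriv_fun_zero
    rw [this]; simp
  · ext x idx; exact (hd ℏ x idx).symm

end Scattering16

namespace Scattering16
open MeasureTheory

lemma IsTropPoly.inter {r : ℕ} {P Q : Set (Fin r → ℝ)} (hP : IsTropPoly P) (hQ : IsTropPoly Q) :
    IsTropPoly (P ∩ Q) := by
  classical
  obtain ⟨S, rfl⟩ := hP
  obtain ⟨T, rfl⟩ := hQ
  refine ⟨S ∪ T, ?_⟩
  ext x
  simp only [Set.mem_inter_iff, Set.mem_iInter, Finset.mem_union, or_imp, forall_and]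

lemma trop_half {r : ℕ} (n : Fin r → ℚ) (b : ℚ) : IsTropPoly {x : Fin r → ℝ | ∑ i, x i * (n i : ℝ) ≤ b} :=
  ⟨{(n, b)}, by simp⟩

lemma trop_eq {r : ℕ} (n : Fin r → ℚ) (b : ℚ) : IsTropPoly {x : Fin r → ℝ | ∑ i, x i * (n i : ℝ) = b} := by
  convert (trop_half n b).inter (trop_half (-n) (-b)) using 1
  ext x
  simp only [Set.mem_inter_iff, Set.mem_ofPred_eq, Pi.neg_apply, Rat.cast_neg, mul_neg, Finset.sum_neg_distrib, neg_le_neg_iff]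
  exact le_antisymm_iff

lemma fm_aux {A : Type*} (S : Finset A) (a μ : A → ℝ) :
    (∃ t : ℝ, 0 ≤ t ∧ ∀ p ∈ S, a p + t * μ p ≤ 0) ↔
    (∀ p ∈ S, 0 ≤ μ p → a p ≤ 0) ∧ (∀ p ∈ S, ∀ q ∈ S, 0 < μ p → μ q < 0 → μ p * a q - μ q * a p ≤ 0) := by
  classical
  constructor
  · rintro ⟨t, ht, h⟩
    refine ⟨fun p hp hm => ?_, fun p hp q hq h1 h2 => ?_⟩
    · have := h p hp; nlinarith [mul_nonneg ht hm]
    · have e1 := h p hp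
      have e2 := h q hq
      nlinarith [mul_nonneg h1.le (neg_nonneg.2 e2), mul_nonneg (neg_nonneg.2 h2.le) (neg_nonneg.2 e1)]
  · rintro ⟨h1, h2⟩
    let T : Finset ℝ := insert 0 ((S.filter fun q => μ q < 0).image fun q => a q / (-μ q))
    have hT : T.Nonempty := ⟨0, Finset.mem_insert_self _ _⟩
    refine ⟨T.max' hT, T.le_max' 0 (Finset.mem_insert_self _ _), fun p hp => ?_⟩
    rcases lt_trichotomy (μ p) 0 with hm | hm | hm
    · have h3 : a p / (-μ p) ≤ T.max' hT := T.le_max' _ (Finset.mem_insert_of_mem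
        (Finset.mem_image_of_mem _ (Finset.mem_filter.2 ⟨hp, hm⟩)))
      rw [div_le_iff₀ (by linarith)] at h3
      linarith
    · rw [hm, mul_zero, add_zero]; exact h1 p hp hm.ge
    · have hle : T.max' hT ≤ - a p / μ p := by
        apply Finset.max'_le
        intro y hy
        rcases Finset.mem_insert.1 hy with rfl | hy
        · exact div_nonneg (by linarith [h1 p hp hm.le]) hm.le
        · obtain ⟨q, hq, rfl⟩ := Finset.mem_image.1 hy
          obtain ⟨hq, hq'⟩ := Finset.mem_filter.1 hq
          rw [div_le_div_iff₀ (by linarith) hm]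
          linarith [h2 p hp q hq hm hq']
      rw [le_div_iff₀ hm] at hle
      linarith

lemma trop_fm {r : ℕ} {R : Set (Fin r → ℝ)} (hR : IsTropPoly R) (m : Fin r → ℤ) :
    IsTropPoly {x : Fin r → ℝ | ∃ y, y ∈ R ∧ ∃ t : ℝ, 0 ≤ t ∧ x = y - t • toR m} := by
  classical
  obtain ⟨S, rfl⟩ := hR
  let μ : ((Fin r → ℚ) × ℚ) → ℚ := fun p => ∑ i, (m i : ℚ) * p.1 i
  refine ⟨(S.filter fun p => 0 ≤ μ p) ∪
    (((S ×ˢ S).filter fun z => 0 < μ z.1 ∧ μ z.2 < 0).image fun z =>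
      (μ z.1 • z.2.1 - μ z.2 • z.1.1, μ z.1 * z.2.2 - μ z.2 * z.1.2)), ?_⟩
  ext x
  have key := fm_aux S (fun p => (∑ i, x i * (p.1 i : ℝ)) - (p.2 : ℝ)) (fun p => (μ p : ℝ))
  have e1 : (x ∈ {x : Fin r → ℝ | ∃ y, y ∈ (⋂ p ∈ S, {x : Fin r → ℝ | (∑ i, x i * ((p.1 i : ℝ))) ≤ (p.2 : ℝ)}) ∧ ∃ t : ℝ, 0 ≤ t ∧ x = y - t • toR m}) ↔
      ∃ t : ℝ, 0 ≤ t ∧ ∀ p ∈ S, ((∑ i, x i * (p.1 i : ℝ)) - (p.2 : ℝ)) + t * (μ p : ℝ) ≤ 0 := by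
    have e2 : ∀ t : ℝ, ∀ p : ((Fin r → ℚ) × ℚ), ∑ i, (x + t • toR m) i * (p.1 i : ℝ) =
        (∑ i, x i * (p.1 i : ℝ)) + t * (μ p : ℝ) := by
      intro t p
      simp only [Pi.add_apply, Pi.smul_apply, smul_eq_mul, toR, add_mul, Finset.sum_add_distrib, μ]
      push_cast
      rw [Finset.mul_sum]
      simp only [mul_assoc]
    constructor
    · rintro ⟨y, hy, t, ht, rfl⟩
      refine ⟨t, ht, fun p hp => ?_⟩
      have := Set.mem_iInter₂.1 hy p hp
      have h3 := e2 t p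
      rw [sub_add_cancel] at h3
      simp only [Set.mem_ofPred_eq] at this
      linarith
    · rintro ⟨t, ht, h⟩
      refine ⟨x + t • toR m, Set.mem_iInter₂.2 fun p hp => ?_, t, ht, by simp⟩
      simp only [Set.mem_ofPred_eq]
      rw [e2]; linarith [h p hp]
  rw [e1, key]
  simp only [Set.mem_iInter, Finset.mem_union, or_imp, forall_and, Set.mem_ofPred_eq, Finset.mem_filter, and_imp]
  refine and_congr ⟨fun h p hp hm => by have := h p hp (by exact_mod_cast hm); linarith,
    fun h p hp hm => by have := h p hp (by exact_mod_cast hm); linarith⟩ ?_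
  have e3 : ∀ p q : ((Fin r → ℚ) × ℚ), ∑ i, x i * (((μ p • q.1 - μ q • p.1) i : ℚ) : ℝ) =
      (μ p : ℝ) * ∑ i, x i * (q.1 i : ℝ) - (μ q : ℝ) * ∑ i, x i * (p.1 i : ℝ) := by
    intro p q
    rw [Finset.mul_sum, Finset.mul_sum, ← Finset.sum_sub_distrib]
    refine Finset.sum_congr rfl fun i _ => ?_
    simp only [Pi.sub_apply, Pi.smul_apply, smul_eq_mul]; push_cast; ring
  constructor
  · intro h z hz
    obtain ⟨⟨p, q⟩, hpq, rfl⟩ := Finset.mem_image.1 hz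
    obtain ⟨hS, h1, h2⟩ := Finset.mem_filter.1 hpq
    obtain ⟨hp, hq⟩ := Finset.mem_product.1 hS
    have := h p hp q hq (by exact_mod_cast h1) (by exact_mod_cast h2)
    rw [e3]; push_cast
    linarith
  · intro h p hp q hq h1 h2
    have := h _ (Finset.mem_image_of_mem _ (Finset.mem_filter.2 ⟨Finset.mem_product.2 (⟨hp, hq⟩ : (p, q).1 ∈ S ∧ (p, q).2 ∈ S),
      by exact_mod_cast h1, by exact_mod_cast h2⟩))
    rw [e3] at this; push_cast at this
    linarith

lemma trop_stops {r : ℕ} {ι : Type} (w : ι → Wall r) : ∀ T : Tree ι, IsTropPoly (T.stops w)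
  | .leaf i => by
      have := trop_eq (fun p => ((w i).nvec p : ℚ)) (w i).c
      convert this using 1
      ext x
      simp [Tree.stops, Wall.support, Wall.eta, dotR, toR, sub_eq_zero]
  | .node t₁ t₂ => trop_fm ((trop_stops w t₁).inter (trop_stops w t₂)) _

lemma trop_stopsM {r : ℕ} {ι : Type} (w : ι → Wall r) : ∀ J : MTree ι r, IsTropPoly (J.stopsM w)
  | .mleaf _ => tropUniv r
  | .graftL L J => trop_fm ((trop_stops w L).inter (trop_stopsM w J)) _
  | .graftR J L => trop_fm ((trop_stopsM w J).inter (trop_stops w L)) _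

end Scattering16

namespace Scattering16
open MeasureTheory

lemma gaussProd_eq {r : ℕ} {ι : Type} (w : ι → Wall r) (ℏ : ℝ) : ∀ (T : Tree ι) (ℓ : T.Lengths) (x : Fin r → ℝ),
    T.gaussProd w ℏ ℓ x = ∏ j, Tree.gauss ℏ (T.etaFin w ℓ x j)
  | .leaf i, ℓ, x => by
      show _ = ∏ j : Fin 1, _
      simp [Tree.gaussProd, Tree.etaFin]
  | .node t₁ t₂, ℓ, x => by
      show _ = ∏ j : Fin (t₁.numLeaves + t₂.numLeaves), _
      rw [Fin.prod_univ_add]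
      simp only [Tree.etaFin, Fin.append_left, Fin.append_right, Tree.gaussProd]
      rw [gaussProd_eq w ℏ t₁, gaussProd_eq w ℏ t₂]

lemma gaussProdM_eq {r : ℕ} {ι : Type} (w : ι → Wall r) (ℏ : ℝ) : ∀ (J : MTree ι r) (ℓ : J.LengthsM) (x : Fin r → ℝ),
    J.gaussProdM w ℏ ℓ x = ∏ j, Tree.gauss ℏ (J.etaFinM w ℓ x j)
  | .mleaf i, ℓ, x => by
      show _ = ∏ j : Fin 0, _
      simp [MTree.gaussProdM]
  | .graftL L J, ℓ, x => by
      show _ = ∏ j : Fin (L.numLeaves + J.numULeaves), _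
      rw [Fin.prod_univ_add]
      simp only [MTree.etaFinM, Fin.append_left, Fin.append_right, MTree.gaussProdM]
      rw [gaussProd_eq w ℏ L, gaussProdM_eq w ℏ J]
  | .graftR J L, ℓ, x => by
      show _ = ∏ j : Fin (J.numULeaves + L.numLeaves), _
      rw [Fin.prod_univ_add]
      simp only [MTree.etaFinM, Fin.append_left, Fin.append_right, MTree.gaussProdM]
      rw [gaussProd_eq w ℏ L, gaussProdM_eq w ℏ J]

lemma append_zero {a b : ℕ} (u : Fin a → ℝ) (v : Fin b → ℝ) :
    (∀ j, Fin.append u v j = 0) ↔ (∀ j, u j = 0) ∧ (∀ j, v j = 0) := by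
  constructor
  · intro h
    exact ⟨fun j => by simpa using h (Fin.castAdd b j), fun j => by simpa using h (Fin.natAdd a j)⟩
  · rintro ⟨h1, h2⟩ j
    induction j using Fin.addCases with
    | left j => simpa using h1 j
    | right j => simpa using h2 j

lemma stops_aux {r : ℕ} {E1 E2 : Type} (S1 S2 : Set (Fin r → ℝ)) (Np1 : E1 → Prop) (Np2 : E2 → Prop)
    {a b : ℕ} (eta1 : E1 → (Fin r → ℝ) → Fin a → ℝ) (eta2 : E2 → (Fin r → ℝ) → Fin b → ℝ)
    (h1 : ∀ x, x ∈ S1 ↔ ∃ ℓ, Np1 ℓ ∧ ∀ j, eta1 ℓ x j = 0)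
    (h2 : ∀ x, x ∈ S2 ↔ ∃ ℓ, Np2 ℓ ∧ ∀ j, eta2 ℓ x j = 0) (m : Fin r → ℝ) (x : Fin r → ℝ) :
    (∃ y, (y ∈ S1 ∧ y ∈ S2) ∧ ∃ t : ℝ, 0 ≤ t ∧ x = y - t • m) ↔
    ∃ ℓ : E1 × E2 × ℝ, (Np1 ℓ.1 ∧ Np2 ℓ.2.1 ∧ ℓ.2.2 ≤ 0) ∧
      ∀ j, Fin.append (eta1 ℓ.1 (x - ℓ.2.2 • m)) (eta2 ℓ.2.1 (x - ℓ.2.2 • m)) j = 0 := by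
  constructor
  · rintro ⟨y, ⟨hy1, hy2⟩, t, ht, rfl⟩
    obtain ⟨l1, n1, e1⟩ := (h1 y).1 hy1
    obtain ⟨l2, n2, e2⟩ := (h2 y).1 hy2
    refine ⟨(l1, l2, -t), ⟨n1, n2, by simpa using ht⟩, ?_⟩
    have : y - t • m - (-t) • m = y := by rw [neg_smul]; abel
    simp only [this]
    exact (append_zero _ _).2 ⟨e1, e2⟩
  · rintro ⟨⟨l1, l2, s⟩, ⟨n1, n2, hs⟩, h⟩
    obtain ⟨e1, e2⟩ := (append_zero _ _).1 h
    exact ⟨x - s • m, ⟨(h1 _).2 ⟨l1, n1, e1⟩, (h2 _).2 ⟨l2, n2, e2⟩⟩, -s, by simpa using hs, by rw [neg_smul]; abel⟩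

lemma stops_iff {r : ℕ} {ι : Type} (w : ι → Wall r) : ∀ (T : Tree ι) (x : Fin r → ℝ),
    x ∈ T.stops w ↔ ∃ ℓ : T.Lengths, T.Nonpos ℓ ∧ ∀ j, T.etaFin w ℓ x j = 0
  | .leaf i, x => by
      constructor
      · intro h; exact ⟨(), trivial, fun _ => h⟩
      · rintro ⟨_, _, h⟩; exact h (0 : Fin 1)
  | .node t₁ t₂, x => stops_aux _ _ _ _ _ _ (stops_iff w t₁) (stops_iff w t₂) _ x

lemma stopsM_iff {r : ℕ} {ι : Type} (w : ι → Wall r) : ∀ (J : MTree ι r) (x : Fin r → ℝ),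
    x ∈ J.stopsM w ↔ ∃ ℓ : J.LengthsM, J.NonposM ℓ ∧ ∀ j, J.etaFinM w ℓ x j = 0
  | .mleaf i, x => by
      constructor
      · intro h; exact ⟨(), trivial, fun j => (j : Fin 0).elim0⟩
      · intro _; trivial
  | .graftL L J, x => stops_aux _ _ _ _ _ _ (stops_iff w L) (stopsM_iff w J) _ x
  | .graftR J L, x => stops_aux _ _ _ _ _ _ (stopsM_iff w J) (stops_iff w L) _ x

lemma numLeaves_eq {ι : Type} : ∀ T : Tree ι, T.numLeaves = T.numNodes + 1
  | .leaf _ => rfl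
  | .node t₁ t₂ => by
      simp only [Tree.numLeaves, Tree.numNodes, numLeaves_eq t₁, numLeaves_eq t₂]; omega

lemma numULeaves_eq {ι : Type} {r : ℕ} : ∀ J : MTree ι r, J.numNodesM = J.numULeaves
  | .mleaf _ => rfl
  | .graftL L J => by
      simp only [MTree.numULeaves, MTree.numNodesM, numLeaves_eq L, numULeaves_eq J]; omega
  | .graftR J L => by
      simp only [MTree.numULeaves, MTree.numNodesM, numLeaves_eq L, numULeaves_eq J]; omega

end Scattering16

namespace Scattering16
open MeasureTheory

def Good {E : Type} [AddCommGroup E] [MeasureSpace E] (r n k : ℕ) (Np : E → Prop) (basis : Fin n → E)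
    (eta : E → (Fin r → ℝ) → Fin k → ℝ) : Prop :=
  ∃ e : E ≃ᵐ (Fin n → ℝ), MeasurePreserving e volume volume ∧ e 0 = 0 ∧ (∀ a, e (basis a) = Pi.single a 1) ∧
    (∀ ℓ, Np ℓ ↔ ∀ i, e ℓ i ≤ 0) ∧
    ∃ (N : Fin k → Fin r → ℤ) (c : Fin k → ℚ) (A : Fin k → Fin n → ℤ),
      ∀ ℓ x j, eta ℓ x j = dotR x (toR (N j)) - (c j : ℝ) + ∑ a, (A j a : ℝ) * e ℓ a

lemma exists_e {E1 E2 : Type} [MeasureSpace E1] [MeasureSpace E2] {n1 n2 : ℕ}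
    (e1 : E1 ≃ᵐ (Fin n1 → ℝ)) (h1 : MeasurePreserving e1 volume volume)
    (e2 : E2 ≃ᵐ (Fin n2 → ℝ)) (h2 : MeasurePreserving e2 volume volume) :
    ∃ e : (E1 × E2 × ℝ) ≃ᵐ (Fin (n1 + (n2 + 1)) → ℝ), MeasurePreserving e volume volume ∧
      (∀ ℓ i, e ℓ (Fin.castAdd (n2+1) i) = e1 ℓ.1 i) ∧
      (∀ ℓ i, e ℓ (Fin.natAdd n1 (Fin.castSucc i)) = e2 ℓ.2.1 i) ∧
      (∀ ℓ, e ℓ (Fin.natAdd n1 (Fin.last n2)) = ℓ.2.2) := by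
  have s1 : SFinite (volume : Measure E1) := by
    rw [← (h1.symm).map_eq]; infer_instance
  have s2 : SFinite (volume : Measure E2) := by
    rw [← (h2.symm).map_eq]; infer_instance
  let a1 : (E1 × E2 × ℝ) ≃ᵐ ((Fin n1 → ℝ) × (Fin n2 → ℝ) × ℝ) :=
    e1.prodCongr (e2.prodCongr (MeasurableEquiv.refl ℝ))
  have m1 : MeasurePreserving a1 volume volume :=
    h1.prod (h2.prod (MeasurePreserving.id volume))
  let b : ((Fin n2 → ℝ) × ℝ) ≃ᵐ (Fin (n2+1) → ℝ) :=
    (MeasurableEquiv.prodComm).trans (MeasurableEquiv.piFinSuccAbove (fun _ => ℝ) (Fin.last n2)).symm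
  have mb : MeasurePreserving b volume volume :=
    ((volume_preserving_piFinSuccAbove (fun _ : Fin (n2+1) => ℝ) (Fin.last n2)).symm).comp Measure.measurePreserving_swap
  let a2 : ((Fin n1 → ℝ) × (Fin n2 → ℝ) × ℝ) ≃ᵐ ((Fin n1 → ℝ) × (Fin (n2+1) → ℝ)) :=
    (MeasurableEquiv.refl _).prodCongr b
  have m2 : MeasurePreserving a2 volume volume := (MeasurePreserving.id volume).prod mb
  let a3 : ((Fin n1 → ℝ) × (Fin (n2+1) → ℝ)) ≃ᵐ (Fin n1 ⊕ Fin (n2+1) → ℝ) :=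
    (MeasurableEquiv.sumPiEquivProdPi (fun _ : Fin n1 ⊕ Fin (n2+1) => ℝ)).symm
  have m3 : MeasurePreserving a3 volume volume :=
    volume_measurePreserving_sumPiEquivProdPi_symm (fun _ : Fin n1 ⊕ Fin (n2+1) => ℝ)
  let a4 : (Fin n1 ⊕ Fin (n2+1) → ℝ) ≃ᵐ (Fin (n1 + (n2+1)) → ℝ) :=
    MeasurableEquiv.piCongrLeft (fun _ => ℝ) finSumFinEquiv
  have m4 : MeasurePreserving a4 volume volume :=
    volume_measurePreserving_piCongrLeft (fun _ => ℝ) finSumFinEquiv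
  have h4 : ∀ v s, a4 v (finSumFinEquiv s) = v s := fun v s =>
    Equiv.piCongrLeft_apply_apply (fun _ => ℝ) finSumFinEquiv v s
  refine ⟨((a1.trans a2).trans a3).trans a4, m4.comp (m3.comp (m2.comp m1)), fun ℓ i => ?_, fun ℓ i => ?_, fun ℓ => ?_⟩
  · exact h4 _ (Sum.inl i)
  · refine (h4 _ (Sum.inr (Fin.castSucc i))).trans ?_
    show (Fin.insertNth (α := fun _ => ℝ) (Fin.last n2) ℓ.2.2 (e2 ℓ.2.1)) (Fin.castSucc i) = _
    rw [← Fin.succAbove_last_apply, Fin.insertNth_apply_succAbove]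
  · refine (h4 _ (Sum.inr (Fin.last n2))).trans ?_
    show (Fin.insertNth (α := fun _ => ℝ) (Fin.last n2) ℓ.2.2 (e2 ℓ.2.1)) (Fin.last n2) = _
    rw [Fin.insertNth_apply_same]

lemma dotR_sub_smul {r : ℕ} (x : Fin r → ℝ) (s : ℝ) (m n : Fin r → ℤ) :
    dotR (x - s • toR m) (toR n) = dotR x (toR n) - s * ((∑ i, m i * n i : ℤ) : ℝ) := by
  unfold dotR toR
  push_cast
  rw [Finset.mul_sum, ← Finset.sum_sub_distrib]
  refine Finset.sum_congr rfl fun i _ => ?_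
  simp only [Pi.sub_apply, Pi.smul_apply, smul_eq_mul]; ring

lemma Good.prod {E1 E2 : Type} [AddCommGroup E1] [MeasureSpace E1] [AddCommGroup E2] [MeasureSpace E2]
    {r n1 n2 k1 k2 : ℕ} {Np1 : E1 → Prop} {Np2 : E2 → Prop} {b1 : Fin n1 → E1} {b2 : Fin n2 → E2}
    {eta1 : E1 → (Fin r → ℝ) → Fin k1 → ℝ} {eta2 : E2 → (Fin r → ℝ) → Fin k2 → ℝ}
    (g1 : Good r n1 k1 Np1 b1 eta1) (g2 : Good r n2 k2 Np2 b2 eta2) (m : Fin r → ℤ) :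
    Good (E := E1 × E2 × ℝ) r (n1 + (n2 + 1)) (k1 + k2) (fun ℓ => Np1 ℓ.1 ∧ Np2 ℓ.2.1 ∧ ℓ.2.2 ≤ 0)
      (Fin.addCases (m := n1) (n := n2 + 1) (fun a => (b1 a, 0, 0))
        (fun b => Fin.lastCases ((0 : E1), (0 : E2), (1:ℝ)) (fun b' => ((0 : E1), b2 b', (0:ℝ))) b))
      (fun ℓ x => Fin.append (eta1 ℓ.1 (x - ℓ.2.2 • toR m)) (eta2 ℓ.2.1 (x - ℓ.2.2 • toR m))) := by
  obtain ⟨e1, h1, z1, B1, P1, N1, c1, A1, H1⟩ := g1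
  obtain ⟨e2, h2, z2, B2, P2, N2, c2, A2, H2⟩ := g2
  obtain ⟨e, he, ea, eb, ec⟩ := exists_e e1 h1 e2 h2
  have ext' : ∀ u v : Fin (n1 + (n2+1)) → ℝ, (∀ i, u (Fin.castAdd (n2+1) i) = v (Fin.castAdd (n2+1) i)) →
      (∀ i, u (Fin.natAdd n1 (Fin.castSucc i)) = v (Fin.natAdd n1 (Fin.castSucc i))) →
      u (Fin.natAdd n1 (Fin.last n2)) = v (Fin.natAdd n1 (Fin.last n2)) → u = v := by
    intro u v h1 h2 h3
    ext i
    induction i using Fin.addCases with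
    | left i => exact h1 i
    | right i =>
      induction i using Fin.lastCases with
      | last => exact h3
      | cast i => exact h2 i
  refine ⟨e, he, ?_, ?_, ?_, Fin.append N1 N2, Fin.append c1 c2,
    Fin.append (fun j => Fin.append (A1 j) (Fin.snoc (fun _ => 0) (-∑ i, m i * N1 j i)))
      (fun j => Fin.append (fun _ => 0) (Fin.snoc (A2 j) (-∑ i, m i * N2 j i))), ?_⟩
  · apply ext' <;> intros <;> simp [-Fin.natAdd_last, ea, eb, ec, z1, z2]
  · intro a
    induction a using Fin.addCases with
    | left a =>
      apply ext' <;> intros <;> simp [-Fin.natAdd_last, ea, eb, ec, z1, z2, B1, B2, Pi.single_apply, Fin.ext_iff] <;> intros <;> omega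
    | right a =>
      induction a using Fin.lastCases with
      | last =>
        apply ext' <;> intros <;> simp [-Fin.natAdd_last, ea, eb, ec, z1, z2, B1, B2, Pi.single_apply, Fin.ext_iff] <;> intros <;> omega
      | cast a =>
        apply ext' <;> intros <;> simp [-Fin.natAdd_last, ea, eb, ec, z1, z2, B1, B2, Pi.single_apply, Fin.ext_iff] <;> intros <;> omega
  · intro ℓ
    show (Np1 ℓ.1 ∧ Np2 ℓ.2.1 ∧ ℓ.2.2 ≤ 0) ↔ _
    rw [P1, P2]
    constructor
    · rintro ⟨u1, u2, u3⟩ i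
      induction i using Fin.addCases with
      | left i => rw [ea]; exact u1 i
      | right i =>
        induction i using Fin.lastCases with
        | last => rw [ec]; exact u3
        | cast i => rw [eb]; exact u2 i
    · intro h
      exact ⟨fun i => by rw [← ea]; exact h _, fun i => by rw [← eb]; exact h _, by rw [← ec]; exact h _⟩
  · intro ℓ x j
    rw [Fin.sum_univ_add, Fin.sum_univ_castSucc]
    simp only [ea, eb, ec]
    induction j using Fin.addCases with
    | left j =>
      simp only [Fin.append_left, Fin.append_right, Fin.snoc_castSucc, Fin.snoc_last]
      rw [H1, dotR_sub_smul]
      simp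
      ring
    | right j =>
      simp only [Fin.append_left, Fin.append_right, Fin.snoc_castSucc, Fin.snoc_last]
      rw [H2, dotR_sub_smul]
      simp
      ring

lemma meas_unit_fin0 : ∃ e : Unit ≃ᵐ (Fin 0 → ℝ), MeasurePreserving e volume volume := by
  refine ⟨MeasurableEquiv.ofUniqueOfUnique Unit (Fin 0 → ℝ), (MeasurableEquiv.measurable _), ?_⟩
  ext s hs
  rw [MeasurableEquiv.map_apply]
  rw [volume_pi, Measure.pi_of_empty _ (fun i => i.elim0)]
  rw [show (volume : Measure Unit) = Measure.dirac () from rfl]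
  rw [Measure.dirac_apply, Measure.dirac_apply]
  by_cases h : s = ∅
  · subst h; simp
  · have : s = Set.univ := Subsingleton.eq_univ_of_nonempty (Set.nonempty_iff_ne_empty.2 h)
    subst this; simp

lemma tree_good {r : ℕ} {ι : Type} (w : ι → Wall r) : ∀ T : Tree ι,
    Good r T.numNodes T.numLeaves T.Nonpos T.basisL (T.etaFin w)
  | .leaf i => by
      obtain ⟨e, he⟩ := meas_unit_fin0
      refine ⟨e, he, funext fun j => (j : Fin 0).elim0, fun a => (a : Fin 0).elim0, fun ℓ => ⟨fun _ j => (j : Fin 0).elim0, fun _ => trivial⟩,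
        fun _ => (w i).nvec, fun _ => (w i).c, fun _ a => 0, fun ℓ x j => ?_⟩
      simp [Tree.etaFin, Wall.eta]
  | .node t₁ t₂ => (tree_good w t₁).prod (tree_good w t₂) (t₁.mOf w + t₂.mOf w)

lemma mtree_good {r : ℕ} {ι : Type} (w : ι → Wall r) : ∀ J : MTree ι r,
    Good r J.numNodesM J.numULeaves J.NonposM J.basisLM (J.etaFinM w)
  | .mleaf i => by
      obtain ⟨e, he⟩ := meas_unit_fin0
      exact ⟨e, he, funext fun j => (j : Fin 0).elim0, fun a => (a : Fin 0).elim0, fun ℓ => ⟨fun _ j => (j : Fin 0).elim0, fun _ => trivial⟩,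
        fun j => (j : Fin 0).elim0, fun j => (j : Fin 0).elim0, fun j => (j : Fin 0).elim0, fun ℓ x j => (j : Fin 0).elim0⟩
  | .graftL L J => (tree_good w L).prod (mtree_good w J) (L.mOf w + J.mOfM w)
  | .graftR J L => (mtree_good w J).prod (tree_good w L) (J.mOfM w + L.mOf w)

end Scattering16

namespace Scattering16
open MeasureTheory
open scoped Pointwise

lemma gauss_nonpos (ℏ : ℝ) (h : ℏ ≤ 0) (t : ℝ) : Tree.gauss ℏ t = 0 := by
  unfold Tree.gauss
  have : (Real.pi * ℏ) ^ (-(1:ℝ)/2) = 0 := by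
    rcases h.lt_or_eq with h | h
    · rw [Real.rpow_def_of_neg (mul_neg_of_pos_of_neg Real.pi_pos h)]
      have : Real.cos (-(1:ℝ)/2 * Real.pi) = 0 := by
        rw [show -(1:ℝ)/2 * Real.pi = -(Real.pi/2) by ring, Real.cos_neg, Real.cos_pi_div_two]
      rw [this, mul_zero]
    · rw [h, mul_zero, Real.zero_rpow (by norm_num)]
  rw [this, zero_mul]

lemma gauss_prod {k : ℕ} (T : (Fin k → ℝ) →L[ℝ] (Fin k → ℝ)) (ℏ : ℝ) (h : 0 < ℏ) (u : Fin k → ℝ) :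
    ∏ j, Tree.gauss ℏ (T u j) = ((Real.pi * ℏ) ^ (-(1:ℝ)/2)) ^ k * fQ T ((Real.sqrt ℏ)⁻¹ • u) := by
  unfold Tree.gauss fQ Qf
  rw [Finset.prod_mul_distrib, Finset.prod_const, Finset.card_univ, Fintype.card_fin, ← Real.exp_sum]
  congr 2
  rw [← Finset.sum_neg_distrib]
  refine Finset.sum_congr rfl fun j _ => ?_
  rw [map_smul, Pi.smul_apply, smul_eq_mul, mul_pow, sqrtinv_sq h]
  ring

lemma smul_Orth {k : ℕ} (R : ℝ) (hR : 0 < R) : R • Orth k = Orth k := by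
  ext u
  rw [Set.mem_smul_set_iff_inv_smul_mem₀ hR.ne']
  simp only [Orth, Set.mem_ofPred_eq, Pi.smul_apply, smul_eq_mul]
  refine forall_congr' fun m => ?_
  constructor
  · intro h
    by_contra h'
    push Not at h'
    exact absurd h (not_le.2 (mul_pos (inv_pos.2 hR) h'))
  · intro h; exact mul_nonpos_of_nonneg_of_nonpos (inv_pos.2 hR).le h

lemma int_scale {k : ℕ} (f : (Fin k → ℝ) → ℝ) (ℏ : ℝ) (h : 0 < ℏ) (Y : Fin k → ℝ) :
    ∫ u in Orth k, f ((Real.sqrt ℏ)⁻¹ • (u + Y)) = (Real.sqrt ℏ) ^ k * FS f (Orth k) ((Real.sqrt ℏ)⁻¹ • Y) := by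
  have hs : 0 < (Real.sqrt ℏ)⁻¹ := inv_pos.2 (Real.sqrt_pos.2 h)
  have := Measure.setIntegral_comp_smul_of_pos volume (fun v => f (v + (Real.sqrt ℏ)⁻¹ • Y)) (Orth k) hs
  rw [smul_Orth _ hs] at this
  simp only [← smul_add] at this
  rw [this, FS]
  simp [smul_eq_mul]

lemma const_eq (ℏ : ℝ) (h : 0 < ℏ) (k : ℕ) :
    ((Real.pi * ℏ) ^ (-(1:ℝ)/2)) ^ k * (Real.sqrt ℏ) ^ k = (Real.pi ^ (-(1:ℝ)/2)) ^ k := by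
  rw [← mul_pow, Real.mul_rpow Real.pi_pos.le h.le, mul_assoc, Real.sqrt_eq_rpow, ← Real.rpow_add h]
  norm_num

lemma inj_bound {k : ℕ} (T T' : (Fin k → ℝ) →L[ℝ] (Fin k → ℝ)) (h : ∀ u, T' (T u) = u) :
    ∃ c > 0, GDecay (fQ T) c := by
  obtain ⟨c, hc, h⟩ := fQ_decay T (‖T'‖ + 1) (by positivity) (fun u => by
    calc ‖u‖ = ‖T' (T u)‖ := by rw [h]
      _ ≤ ‖T'‖ * ‖T u‖ := T'.le_opNorm _
      _ ≤ _ := by nlinarith [norm_nonneg (T u)])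
  exact ⟨c, hc, fQ_contDiff T, h⟩

theorem final_abs {E : Type} [AddCommGroup E] [MeasureSpace E] {r k : ℕ} {Np : E → Prop} {basis : Fin k → E}
    {eta : E → (Fin r → ℝ) → Fin k → ℝ} (hg : Good r k k Np basis eta) (α : ℝ → (Fin r → ℝ) → ℝ) (sgn dv : ℝ)
    (hdet : dv = Matrix.det (Matrix.of fun j l => eta (basis l) 0 j - eta 0 0 j))
    (hα : ∀ ℏ x, α ℏ x = sgn * dv * ∫ ℓ in {ℓ | Np ℓ}, ∏ j, Tree.gauss ℏ (eta ℓ x j))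
    (P : Set (Fin r → ℝ)) (hP : ∀ x, x ∈ P ↔ ∃ ℓ, Np ℓ ∧ ∀ j, eta ℓ x j = 0) (hPt : IsTropPoly P) : CoreConcl α P := by
  classical
  by_cases h0 : dv = 0
  · exact core_zero α (fun ℏ x => by rw [hα, h0]; simp) P hPt
  obtain ⟨e, he, ez, eB, eP, N, c, A, H⟩ := hg
  let MQ : Matrix (Fin k) (Fin k) ℚ := Matrix.of fun j a => (A j a : ℚ)
  have hM : (Matrix.of fun j l => eta (basis l) 0 j - eta 0 0 j) = MQ.map (Rat.castHom ℝ) := by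
    ext j l
    simp only [Matrix.of_apply, H, eB, ez, Matrix.map_apply, MQ]
    simp [Pi.single_apply]
  have hdQ : MQ.det ≠ 0 := by
    intro h
    apply h0
    rw [hdet, hM]
    have := RingHom.map_det (Rat.castHom ℝ) MQ
    rw [h, map_zero] at this
    exact this.symm
  have hu : IsUnit MQ.det := isUnit_iff_ne_zero.2 hdQ
  let Q : Matrix (Fin k) (Fin k) ℚ := MQ⁻¹
  let M : Matrix (Fin k) (Fin k) ℝ := MQ.map (Rat.castHom ℝ)
  let M' : Matrix (Fin k) (Fin k) ℝ := Q.map (Rat.castHom ℝ)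
  have hMM' : M * M' = 1 := by
    have := congrArg (fun X => X.map (Rat.castHom ℝ)) (Matrix.mul_nonsing_inv MQ hu)
    simp only [Matrix.map_mul] at this
    refine this.trans ?_
    exact Matrix.map_one _ (map_zero _) (map_one _)
  have hM'M : M' * M = 1 := mul_eq_one_comm.1 hMM'
  let T : (Fin k → ℝ) →L[ℝ] (Fin k → ℝ) := LinearMap.toContinuousLinearMap M.mulVecLin
  let T' : (Fin k → ℝ) →L[ℝ] (Fin k → ℝ) := LinearMap.toContinuousLinearMap M'.mulVecLin
  have hT'T : ∀ u, T' (T u) = u := fun u => by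
    show M'.mulVec (M.mulVec u) = u
    rw [Matrix.mulVec_mulVec, hM'M, Matrix.one_mulVec]
  have hTT' : ∀ u, T (T' u) = u := fun u => by
    show M.mulVec (M'.mulVec u) = u
    rw [Matrix.mulVec_mulVec, hMM', Matrix.one_mulVec]
  obtain ⟨cc, hcc, hf⟩ := inj_bound T T' hT'T
  let nQ : Fin k → Fin r → ℚ := fun i p => ∑ j, Q i j * (N j p : ℚ)
  let dQ : Fin k → ℚ := fun i => ∑ j, Q i j * c j
  let NR : Matrix (Fin k) (Fin r) ℝ := Matrix.of fun j p => (N j p : ℝ)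
  let L : (Fin r → ℝ) →L[ℝ] (Fin k → ℝ) := T'.comp (LinearMap.toContinuousLinearMap NR.mulVecLin)
  let y0 : Fin k → ℝ := - T' (fun j => (c j : ℝ))
  have hNR : ∀ x j, NR.mulVec x j = dotR x (toR (N j)) := fun x j => by
    simp [Matrix.mulVec, dotProduct, dotR, toR, NR, mul_comm]
  have hT : ∀ u j, T u j = ∑ a, (A j a : ℝ) * u a := fun u j => by
    show M.mulVec u j = _
    simp [Matrix.mulVec, dotProduct, M, MQ]
  have hLx : ∀ x i, L x i = ∑ p, x p * (nQ i p : ℝ) := fun x i => by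
    show M'.mulVec (NR.mulVec x) i = _
    simp only [Matrix.mulVec, dotProduct, nQ, M', NR, Matrix.map_apply, Matrix.of_apply]
    push_cast
    simp only [Finset.mul_sum]
    rw [Finset.sum_comm]
    refine Finset.sum_congr rfl fun p _ => Finset.sum_congr rfl fun j _ => ?_
    simp; ring
  have hy0 : ∀ i, y0 i = -(dQ i : ℝ) := fun i => by
    show -(M'.mulVec (fun j => (c j : ℝ)) i) = _
    simp [Matrix.mulVec, dotProduct, dQ, M']
  have heta : ∀ ℓ x j, eta ℓ x j = T (e ℓ + (L x + y0)) j := fun ℓ x j => by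
    have h1 : T (L x + y0) = fun j => dotR x (toR (N j)) - (c j : ℝ) := by
      show T (T' (NR.mulVec x) + - T' (fun j => (c j : ℝ))) = _
      rw [map_add, map_neg, hTT', hTT']
      ext j
      simp [hNR, sub_eq_add_neg]
    rw [map_add, h1, H, Pi.add_apply, hT, add_comm]
  have hset : {ℓ | Np ℓ} = e ⁻¹' (Orth k) := by
    ext ℓ; exact eP ℓ
  refine core_main hcc hf L y0 (sgn * dv * (Real.pi ^ (-(1:ℝ)/2)) ^ k) α (fun ℏ h => ?_) (fun ℏ h => ?_) P (fun x => ?_) hPt (fun i => ?_)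
  · ext x
    rw [hα, hset]
    simp only [heta]
    have := he.setIntegral_preimage_emb e.measurableEmbedding
      (fun u => ∏ j, Tree.gauss ℏ (T (u + (L x + y0)) j)) (Orth k)
    rw [this]
    simp only [gauss_prod T ℏ h]
    rw [integral_const_mul, int_scale _ ℏ h, ← const_eq ℏ h k]
    ring
  · refine ⟨sgn * dv * ∫ ℓ in {ℓ | Np ℓ}, ∏ _j : Fin k, (0:ℝ), ?_⟩
    ext x
    rw [hα]
    simp only [gauss_nonpos ℏ h]
  · rw [hP]
    constructor
    · rintro ⟨ℓ, h1, h2⟩ m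
      have h3 : T (e ℓ + (L x + y0)) = 0 := funext fun j => by rw [← heta]; exact h2 j
      have h4 : e ℓ + (L x + y0) = 0 := by rw [← hT'T (e ℓ + (L x + y0)), h3, map_zero]
      have h5 := congrFun h4 m
      have h6 := (eP ℓ).1 h1 m
      rw [Pi.add_apply] at h5
      have h7 : (0 : Fin k → ℝ) m = 0 := rfl
      linarith
    · intro h
      refine ⟨e.symm (-(L x + y0)), (eP _).2 fun i => ?_, fun j => ?_⟩
      · rw [e.apply_symm_apply, Pi.neg_apply]; linarith [h i]
      · rw [heta, e.apply_symm_apply, neg_add_cancel, map_zero]; rfl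
  · refine hPt.inter ?_
    convert trop_eq (nQ i) (dQ i) using 1
    ext x
    simp only [Set.mem_ofPred_eq, Pi.add_apply]
    rw [hLx, hy0]
    constructor <;> intro h <;> linarith

theorem final_abs' {E : Type} [AddCommGroup E] [MeasureSpace E] {r n k : ℕ} (hnk : n = k) {Np : E → Prop} {basis : Fin n → E}
    {eta : E → (Fin r → ℝ) → Fin k → ℝ} (hg : Good r n k Np basis eta) (α : ℝ → (Fin r → ℝ) → ℝ) (sgn dv : ℝ)
    (hdet : dv = Matrix.det (Matrix.of fun (j : Fin k) (l : Fin k) =>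
      if h : (l : ℕ) < n then eta (basis ⟨l, h⟩) 0 j - eta 0 0 j else 0))
    (hα : ∀ ℏ x, α ℏ x = sgn * dv * ∫ ℓ in {ℓ | Np ℓ}, ∏ j, Tree.gauss ℏ (eta ℓ x j))
    (P : Set (Fin r → ℝ)) (hP : ∀ x, x ∈ P ↔ ∃ ℓ, Np ℓ ∧ ∀ j, eta ℓ x j = 0) (hPt : IsTropPoly P) : CoreConcl α P := by
  subst hnk
  refine final_abs hg α sgn dv ?_ hα P hP hPt
  rw [hdet]
  congr 1
  ext j l
  simp

theorem main_concl {r : ℕ} {ι : Type} (w : ι → Wall r) (J : MTree ι r) :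
    CoreConcl (fun ℏ x => J.alphaM w ℏ x) (J.stopsM w) :=
  final_abs' (numULeaves_eq J) (mtree_good w J) _ ((-1 : ℝ) ^ J.coreLen) (J.detM w) rfl
    (fun ℏ x => by simp only [MTree.alphaM, gaussProdM_eq]) _ (stopsM_iff w J) (trop_stopsM w J)

end Scattering16

namespace Scattering16

open Tree MTree

/-- Lemma `solution_asy_support_marked`. -/
theorem stmt16 (r : ℕ) (ι : Type) (w : ι → Wall r) (J : MTree ι r) :
    -- (1)
    ((Module.finrank ℝ (affineSpan ℝ (stopsM w J)).direction = r →
        ∃ nd : NormalData r 0,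
          HasAsymSupport (toK0 (fun ℏ x => alphaM w ℏ J x)) (stopsM w J) nd 0) ∧
      InW (toK0 (fun ℏ x => alphaM w ℏ J x)) 0 ∧
      (∀ q, q ∉ stopsM w J →
        ExpSmallNear (fun ℏ x => alphaM w ℏ J x) q)) ∧
    -- (2)
    (Module.finrank ℝ (affineSpan ℝ (stopsM w J)).direction = r →
      ∃ (nC : ℕ) (cells : Fin nC → Set (Fin r → ℝ)),
        (∀ a, IsTropPoly (cells a) ∧ cells a ⊆ stopsM w J ∧
          Module.finrank ℝ (affineSpan ℝ (cells a)).direction ≤ r - 1) ∧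
        (∀ q, q ∉ ⋃ a, cells a →
          ExpSmallNear
            (fun ℏ x => extD (toK0 (fun ℏ' y => alphaM w ℏ' J y)) ℏ x) q)) := by
  obtain ⟨⟨h1, h2, h3⟩, h4⟩ := main_concl w J
  exact ⟨⟨fun _ => h1, h2, h3⟩, fun _ => h4⟩

end Scattering16
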